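/- arXiv:1404.4399 — 7 statements merged into one kernel-verified Lean document; each statement's English description precedes it below -/
import Mathlib

section
/- Let k be a perfect field of characteristic p with p ≠ 2 and p ≠ 3, and let U = k[x₁,x₂,x₃,M]/(x₁x₂x₃M − x₁² − x₂² − x₃²). Then U is strongly F-regular: for every nonzero c ∈ U there exist an integer e ≥ 1 and a p^{-e}-linear map ψ on U with ψ(c) = 1. -/
/-- A `p^{-e}`-linear map on a commutative ring `R` of characteristic `p` (with `q = p^e`):
an additive map `ψ : R → R` satisfying `ψ (a ^ q * b) = a * ψ b` for all `a b`. -/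
def IsPeLinear {R : Type*} [CommRing R] (q : ℕ) (ψ : R → R) : Prop :=
  (∀ a b : R, ψ (a + b) = ψ a + ψ b) ∧ (∀ a b : R, ψ (a ^ q * b) = a * ψ b)

/-- `R` is strongly `F`-regular: for every nonzero `c` there exist `e ≥ 1` and a
`p^{-e}`-linear map `ψ` with `ψ c = 1`. -/
def StronglyFRegular (R : Type*) [CommRing R] (p : ℕ) : Prop :=
  ∀ c : R, c ≠ 0 → ∃ e : ℕ, 1 ≤ e ∧ ∃ ψ : R → R, IsPeLinear (p ^ e) ψ ∧ ψ c = 1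

section CartierTrace

open MvPolynomial

variable {σ k : Type*}

lemma coeff_eq_zero_of_mem_supported_compl [Field k] {i : σ} {h : MvPolynomial σ k}
    (hh : h ∈ supported k {i}ᶜ) {m : σ →₀ ℕ} (hm : m i ≠ 0) : coeff m h = 0 := by
  by_contra hne
  have hi : i ∈ h.vars := (mem_vars_iff_mem_support i).2 ⟨m, mem_support_iff.2 hne, Finsupp.mem_support_iff.2 hm⟩
  exact mem_supported.1 hh hi rfl

/-- The exponent vector `(n, …, n)`. -/
noncomputable def constExponent (σ : Type*) [Fintype σ] (n : ℕ) : σ →₀ ℕ :=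
  Finsupp.equivFunOnFinite.symm fun _ => n

@[simp]
lemma constExponent_apply [Fintype σ] (n : ℕ) (i : σ) : constExponent σ n i = n := rfl

lemma injective_smul_add {q : ℕ} (hq : q ≠ 0) (c : σ →₀ ℕ) :
    Function.Injective fun m : σ →₀ ℕ => q • m + c := by
  intro m n h
  ext i
  simpa [hq] using DFunLike.congr_fun h i

variable [Fintype σ] [Field k] [PerfectField k] (p : ℕ) [Fact p.Prime] [CharP k p]

lemma fact_prime_pow_ne_zero (e : ℕ) : p ^ e ≠ 0 := pow_ne_zero _ (Fact.out : p.Prime).ne_zero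

/-- The generator of the `p^{-e}`-linear maps on a polynomial ring over a perfect field: with
`q = p ^ e`, it sends `x ^ (q m + (q - 1))` to `x ^ m` and all other monomials to `0`. -/
noncomputable def cartierTrace (e : ℕ) : MvPolynomial σ k →+ MvPolynomial σ k where
  toFun g := ⟨((AddMonoidAlgebra.coeff g).comapDomain
    (fun m => p ^ e • m + constExponent σ (p ^ e - 1))
    (injective_smul_add (fact_prime_pow_ne_zero p e) _).injOn).mapRange
      (iterateFrobeniusEquiv k p e).symm (map_zero _)⟩
  map_zero' := by
    ext m
    exact map_zero (iterateFrobeniusEquiv k p e).symm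
  map_add' a b := by
    ext m
    exact map_add (iterateFrobeniusEquiv k p e).symm _ _

lemma coeff_cartierTrace (e : ℕ) (g : MvPolynomial σ k) (m : σ →₀ ℕ) :
    coeff m (cartierTrace p e g) = (iterateFrobeniusEquiv k p e).symm
      (coeff (p ^ e • m + constExponent σ (p ^ e - 1)) g) := rfl

lemma iterateFrobeniusEquiv_symm_pow_mul (e : ℕ) (r s : k) :
    (iterateFrobeniusEquiv k p e).symm (r ^ p ^ e * s) =
      r * (iterateFrobeniusEquiv k p e).symm s := by
  rw [map_mul, ← iterateFrobenius_def p e r, ← iterateFrobeniusEquiv_apply,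
    RingEquiv.symm_apply_apply]

lemma cartierTrace_pow_mul (e : ℕ) (a b : MvPolynomial σ k) :
    cartierTrace p e (a ^ p ^ e * b) = a * cartierTrace p e b := by
  induction a using MvPolynomial.induction_on' with
  | add a a' ha ha' => rw [add_pow_char_pow, add_mul, map_add, ha, ha', add_mul]
  | monomial s r =>
    ext m
    have hq := fact_prime_pow_ne_zero p e
    have hle : p ^ e • s ≤ p ^ e • m + constExponent σ (p ^ e - 1) ↔ s ≤ m := by
      simp only [Finsupp.le_def]
      refine forall_congr' fun i => ?_
      simp only [Finsupp.smul_apply, Finsupp.add_apply, constExponent_apply, smul_eq_mul]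
      refine ⟨fun h => ?_, fun h => (Nat.mul_le_mul_left _ h).trans (Nat.le_add_right _ _)⟩
      by_contra! hlt
      have := Nat.mul_le_mul_left (p ^ e) (Nat.succ_le_of_lt hlt)
      rw [Nat.mul_succ] at this
      omega
    rw [coeff_cartierTrace, monomial_pow, coeff_monomial_mul', coeff_monomial_mul']
    simp only [hle]
    split_ifs with h
    · rw [iterateFrobeniusEquiv_symm_pow_mul, coeff_cartierTrace]
      congr 3
      ext i
      have := Nat.mul_le_mul_left (p ^ e) (h i)
      simp only [Finsupp.smul_apply, Finsupp.add_apply, Finsupp.tsub_apply, constExponent_apply,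
        smul_eq_mul, Nat.mul_sub]
      omega
    · exact map_zero _

lemma cartierTrace_X_pow_mul_eq_zero (e : ℕ) {i : σ} {h : MvPolynomial σ k}
    (hh : h ∈ supported k {i}ᶜ) {b : ℕ} (hb : b % p ^ e ≠ p ^ e - 1) :
    cartierTrace p e (X i ^ b * h) = 0 := by
  ext m
  have hq := fact_prime_pow_ne_zero p e
  rw [coeff_cartierTrace, X_pow_eq_monomial, coeff_monomial_mul', coeff_zero]
  split_ifs with hle
  · rw [coeff_eq_zero_of_mem_supported_compl hh, mul_zero, map_zero]
    have h1 := hle i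
    simp only [Finsupp.single_eq_same, Finsupp.smul_apply, Finsupp.add_apply, Finsupp.tsub_apply,
      constExponent_apply, smul_eq_mul] at h1 ⊢
    intro h0
    apply hb
    rw [show b = p ^ e - 1 + p ^ e * m i by omega, Nat.add_mul_mod_self_left]
    exact Nat.mod_eq_of_lt (by omega)
  · exact map_zero _

lemma cartierTrace_monomial_sub_mul (e : ℕ) {g : MvPolynomial σ k}
    (hg : ∀ n ∈ g.support, ∀ i, n i < p ^ e) {m : σ →₀ ℕ} (hm : ∀ i, m i < p ^ e) (a : k) :
    cartierTrace p e (monomial (constExponent σ (p ^ e - 1) - m) a * g) =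
      C ((iterateFrobeniusEquiv k p e).symm (a * coeff m g)) := by
  classical
  ext j
  have hsub : p ^ e • j + constExponent σ (p ^ e - 1) =
      (constExponent σ (p ^ e - 1) - m) + (p ^ e • j + m) := by
    ext i
    have := hm i
    simp only [Finsupp.smul_apply, Finsupp.add_apply, Finsupp.tsub_apply, constExponent_apply,
      smul_eq_mul]
    omega
  rw [coeff_cartierTrace, hsub, coeff_monomial_mul, coeff_C]
  split_ifs with hj
  · subst hj
    simp
  · have hzero : coeff (p ^ e • j + m) g = 0 := by
      by_contra hne
      obtain ⟨i, hi⟩ : ∃ i, j i ≠ 0 := by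
        by_contra! hall
        exact hj (Finsupp.ext fun i => (hall i).symm)
      have h1 := hg _ (mem_support_iff.2 hne) i
      have h2 := Nat.le_mul_of_pos_right (p ^ e) (Nat.pos_of_ne_zero hi)
      simp only [Finsupp.smul_apply, Finsupp.add_apply, smul_eq_mul] at h1
      omega
    rw [hzero, mul_zero, map_zero]

lemma cartierTrace_prod_X_pow (e : ℕ) :
    cartierTrace p e (∏ i, X i ^ (p ^ e - 1) : MvPolynomial σ k) = 1 := by
  classical
  have hq := fact_prime_pow_ne_zero p e
  have h := cartierTrace_monomial_sub_mul (σ := σ) (k := k) p e (g := 1) (m := 0)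
    (fun n hn i => by
      rw [mem_support_iff, ← C_1, coeff_C] at hn
      have : n = 0 := by
        by_contra hne
        exact hn (if_neg (Ne.symm hne))
      subst this
      simpa using Nat.pos_of_ne_zero hq)
    (fun i => by simpa using Nat.pos_of_ne_zero hq) 1
  rw [tsub_zero, mul_one, monomial_eq, Finsupp.prod_fintype _ _ (by simp)] at h
  simpa using h

/-- The trace of a power of a polynomial `d * xᵢ - s` that is linear in the variable `xᵢ`. -/
lemma cartierTrace_linear_pow_mul (e : ℕ) {i : σ} {d s h : MvPolynomial σ k}
    (hd : d ∈ supported k {i}ᶜ) (hs : s ∈ supported k {i}ᶜ) (hh : h ∈ supported k {i}ᶜ)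
    {j : ℕ} (hj : j ≤ p ^ e - 1) :
    cartierTrace p e ((d * X i - s) ^ (p ^ e - 1) * (X i ^ j * h)) =
      cartierTrace p e (X i ^ (p ^ e - 1) *
        (d ^ (p ^ e - 1 - j) * (-s) ^ j * ((p ^ e - 1).choose j : MvPolynomial σ k) * h)) := by
  have hq := fact_prime_pow_ne_zero p e
  have hterm (a : ℕ) : (d * X i) ^ a * (-s) ^ (p ^ e - 1 - a) *
      ((p ^ e - 1).choose a : MvPolynomial σ k) * (X i ^ j * h) = X i ^ (a + j) *
        (d ^ a * (-s) ^ (p ^ e - 1 - a) * ((p ^ e - 1).choose a : MvPolynomial σ k) * h) := by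
    ring
  rw [sub_eq_add_neg, add_pow, Finset.sum_mul, map_sum, Finset.sum_eq_single (p ^ e - 1 - j)]
  · rw [hterm, Nat.sub_add_cancel hj, Nat.sub_sub_self hj, Nat.choose_symm hj]
  · intro a ha hne
    rw [hterm]
    refine cartierTrace_X_pow_mul_eq_zero p e (mul_mem (mul_mem (mul_mem (pow_mem hd _)
      (pow_mem (neg_mem hs) _)) (natCast_mem _ _)) hh) fun hmod => hne ?_
    rw [Finset.mem_range] at ha
    rcases lt_or_ge (a + j) (p ^ e) with hlt | hge
    · rw [Nat.mod_eq_of_lt hlt] at hmod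
      omega
    · rw [Nat.mod_eq_sub_mod hge, Nat.mod_eq_of_lt (by omega)] at hmod
      omega
  · intro hnot
    exact absurd (Finset.mem_range.2 (by omega)) hnot

/-- The `p^{-e}`-linear map `g ↦ Tr (f ^ (q - 1) * v * g)`, with `q = p ^ e`, descends to the
quotient by `f`. -/
lemma exists_isPeLinear_quotient_span_singleton (e : ℕ) (f v : MvPolynomial σ k) :
    ∃ ψ : MvPolynomial σ k ⧸ Ideal.span {f} → MvPolynomial σ k ⧸ Ideal.span {f},
      IsPeLinear (p ^ e) ψ ∧ ∀ g, ψ (Ideal.Quotient.mk _ g) =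
        Ideal.Quotient.mk _ (cartierTrace p e (f ^ (p ^ e - 1) * (v * g))) := by
  have hq := fact_prime_pow_ne_zero p e
  let φ : MvPolynomial σ k →+ MvPolynomial σ k ⧸ Ideal.span {f} :=
    (Ideal.Quotient.mk (Ideal.span {f})).toAddMonoidHom.comp
      ((cartierTrace p e).comp (AddMonoidHom.mulLeft (f ^ (p ^ e - 1) * v)))
  have hφ (g : MvPolynomial σ k) : φ g =
      Ideal.Quotient.mk _ (cartierTrace p e (f ^ (p ^ e - 1) * (v * g))) := by
    rw [← mul_assoc]
    rfl
  have hker (a b : MvPolynomial σ k)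
      (hab : Ideal.Quotient.mk (Ideal.span {f}) a = Ideal.Quotient.mk _ b) : φ a = φ b := by
    rw [Ideal.Quotient.eq, Ideal.mem_span_singleton] at hab
    obtain ⟨c, hc⟩ := hab
    rw [← sub_eq_zero, ← map_sub, hφ, hc, Ideal.Quotient.eq_zero_iff_mem,
      Ideal.mem_span_singleton,
      show f ^ (p ^ e - 1) * (v * (f * c)) = f ^ (p ^ e - 1 + 1) * (v * c) by ring,
      Nat.sub_add_cancel (Nat.pos_of_ne_zero hq), cartierTrace_pow_mul]
    exact dvd_mul_right _ _
  have hout (g : MvPolynomial σ k) : φ (Quotient.out (Ideal.Quotient.mk (Ideal.span {f}) g)) = φ g :=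
    hker _ _ (Ideal.Quotient.mk_out _)
  refine ⟨fun x => φ x.out, ⟨fun a b => ?_, fun a b => ?_⟩, fun g => (hout g).trans (hφ g)⟩
  · obtain ⟨a, rfl⟩ := Ideal.Quotient.mk_surjective a
    obtain ⟨b, rfl⟩ := Ideal.Quotient.mk_surjective b
    simp only [← map_add, hout]
  · obtain ⟨a, rfl⟩ := Ideal.Quotient.mk_surjective a
    obtain ⟨b, rfl⟩ := Ideal.Quotient.mk_surjective b
    simp only [← map_pow, ← map_mul, hout, hφ, ← cartierTrace_pow_mul]
    congr 2
    ring

end CartierTrace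

lemma IsPeLinear.comp {R : Type*} [CommRing R] {q q' : ℕ} {χ ψ : R → R} (hχ : IsPeLinear q χ)
    (hψ : IsPeLinear q' ψ) : IsPeLinear (q * q') (χ ∘ ψ) := by
  refine ⟨fun a b => ?_, fun a b => ?_⟩
  · simp only [Function.comp_apply, hψ.1, hχ.1]
  · simp only [Function.comp_apply, pow_mul, hψ.2, hχ.2]

lemma IsPeLinear.comp_mul_left {R : Type*} [CommRing R] {q : ℕ} {ψ : R → R}
    (hψ : IsPeLinear q ψ) (u : R) : IsPeLinear q fun x => ψ (u * x) := by
  refine ⟨fun a b => ?_, fun a b => ?_⟩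
  · simp only [mul_add, hψ.1]
  · simp only [mul_left_comm u, hψ.2]

/-- If `d` is sent to `1` by some `p^{-e}`-linear map and every nonzero element is sent to `d` by
some `p^{-e}`-linear map, then the ring is strongly `F`-regular. -/
lemma StronglyFRegular.of_element {R : Type*} [CommRing R] {p : ℕ} (d : R)
    (hd : ∃ e, 1 ≤ e ∧ ∃ χ : R → R, IsPeLinear (p ^ e) χ ∧ χ d = 1)
    (h : ∀ c : R, c ≠ 0 → ∃ (e : ℕ) (ψ : R → R), IsPeLinear (p ^ e) ψ ∧ ψ c = d) :
    StronglyFRegular R p := by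
  intro c hc
  obtain ⟨e, he, χ, hχ, hχd⟩ := hd
  obtain ⟨e', ψ, hψ, hψc⟩ := h c hc
  refine ⟨e + e', by omega, χ ∘ ψ, ?_, by simp [hψc, hχd]⟩
  rw [pow_add]
  exact hχ.comp hψ

section Markov

open MvPolynomial

variable {k : Type*} [Field k]

/-- Modulo `d * xᵢ - s`, every polynomial becomes free of `xᵢ` after multiplication by a power of
`d`. -/
lemma exists_dvd_pow_mul_sub_of_linear {σ : Type*} {i : σ} {d s : MvPolynomial σ k}
    (hd : d ∈ supported k {i}ᶜ) (hs : s ∈ supported k {i}ᶜ) (g : MvPolynomial σ k) :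
    ∃ (n : ℕ) (h : MvPolynomial σ k), h ∈ supported k {i}ᶜ ∧ d * X i - s ∣ d ^ n * g - h := by
  induction g using MvPolynomial.induction_on with
  | C a => exact ⟨0, C a, Subalgebra.algebraMap_mem _ a, by simp⟩
  | add g g' hg hg' =>
    obtain ⟨n, h, hh, u, hu⟩ := hg
    obtain ⟨n', h', hh', u', hu'⟩ := hg'
    refine ⟨n + n', d ^ n' * h + d ^ n * h', add_mem (mul_mem (pow_mem hd _) hh)
      (mul_mem (pow_mem hd _) hh'), d ^ n' * u + d ^ n * u', ?_⟩
    linear_combination d ^ n' * hu + d ^ n * hu'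
  | mul_X g j hg =>
    obtain ⟨n, h, hh, u, hu⟩ := hg
    by_cases hij : j = i
    · subst hij
      refine ⟨n + 1, s * h, mul_mem hs hh, d * X j * u + h, ?_⟩
      linear_combination d * X j * hu
    · refine ⟨n, h * X j, mul_mem hh (X_mem_supported.2 hij), u * X j, ?_⟩
      linear_combination X j * hu

lemma Prime.dvd_of_dvd_mul_of_not_dvd {R : Type*} [CommRing R] [IsDomain R] {π f g : R}
    (hπ : Prime π) (hf : ¬ π ∣ f) (h : f ∣ π * g) : f ∣ g := by
  obtain ⟨u, hu⟩ := h
  obtain ⟨w, rfl⟩ := (hπ.dvd_or_dvd (⟨g, hu.symm⟩ : π ∣ f * u)).resolve_left hf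
  exact ⟨w, mul_left_cancel₀ hπ.ne_zero (by rw [hu]; ring)⟩

lemma markov_dvd_of_dvd_prod_X_pow_mul {n : ℕ} {g : MvPolynomial (Fin 4) k}
    (h : (X 0 * X 1 * X 2 * X 3 - (X 0 ^ 2 + X 1 ^ 2 + X 2 ^ 2) : MvPolynomial (Fin 4) k) ∣
      (X 0 * X 1 * X 2) ^ n * g) :
    (X 0 * X 1 * X 2 * X 3 - (X 0 ^ 2 + X 1 ^ 2 + X 2 ^ 2) : MvPolynomial (Fin 4) k) ∣ g := by
  have hX (i j : Fin 4) (hij : j ≠ i) (hi : ∀ v : Fin 4 → k, v = Pi.single j 1 →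
      v 0 * v 1 * v 2 * v 3 - (v 0 ^ 2 + v 1 ^ 2 + v 2 ^ 2) ≠ 0) : ¬ X i ∣
      (X 0 * X 1 * X 2 * X 3 - (X 0 ^ 2 + X 1 ^ 2 + X 2 ^ 2) : MvPolynomial (Fin 4) k) := by
    intro hdvd
    have := map_dvd (eval (Pi.single j (1 : k))) hdvd
    rw [eval_X, Pi.single_eq_of_ne hij.symm, zero_dvd_iff] at this
    exact hi _ rfl (by simpa using this)
  have h0 := hX 0 1 (by decide) (by rintro v rfl; simp)
  have h1 := hX 1 0 (by decide) (by rintro v rfl; simp)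
  have h2 := hX 2 0 (by decide) (by rintro v rfl; simp)
  induction n with
  | zero => simpa using h
  | succ n ih =>
    refine ih (Prime.dvd_of_dvd_mul_of_not_dvd X_prime h2 (Prime.dvd_of_dvd_mul_of_not_dvd
      X_prime h1 (Prime.dvd_of_dvd_mul_of_not_dvd X_prime h0 ?_)))
    convert h using 1
    ring

lemma prod_X_mem_supported : (X 0 * X 1 * X 2 : MvPolynomial (Fin 4) k) ∈ supported k {3}ᶜ :=
  mul_mem (mul_mem (X_mem_supported.2 (by simp)) (X_mem_supported.2 (by simp)))
    (X_mem_supported.2 (by simp))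

lemma sum_X_sq_mem_supported :
    (X 0 ^ 2 + X 1 ^ 2 + X 2 ^ 2 : MvPolynomial (Fin 4) k) ∈ supported k {3}ᶜ :=
  add_mem (add_mem (pow_mem (X_mem_supported.2 (by simp)) _)
    (pow_mem (X_mem_supported.2 (by simp)) _)) (pow_mem (X_mem_supported.2 (by simp)) _)

variable (p : ℕ) [Fact p.Prime] [CharP k p]

lemma natCast_six_mul_choose_ne_zero (hp2 : p ≠ 2) (hp3 : p ≠ 3) :
    (6 * ((p - 1).choose 3 : k)) ≠ 0 := by
  have hp : p.Prime := Fact.out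
  have h4 : p ≠ 4 := by rintro rfl; exact absurd hp (by norm_num)
  have := hp.two_le
  intro h
  rw [show (6 * ((p - 1).choose 3 : k)) = ((2 * 3 * (p - 1).choose 3 : ℕ) : k) by
    push_cast; ring, CharP.cast_eq_zero_iff k p, hp.dvd_mul, hp.dvd_mul,
    Nat.prime_dvd_prime_iff_eq hp Nat.prime_two, Nat.prime_dvd_prime_iff_eq hp Nat.prime_three] at h
  rcases h with (h | h) | h
  · exact hp2 h
  · exact hp3 h
  · have hdvd : p ∣ (p - 1).factorial :=
      (h.mul_right _).mul_right _ |>.trans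
        (dvd_of_eq (Nat.choose_mul_factorial_mul_factorial (by omega)))
    have := hp.dvd_factorial.1 hdvd
    omega

variable [PerfectField k]

/-- The Fedder-type computation behind strong `F`-regularity of the Markov upper cluster algebra. -/
lemma cartierTrace_markov (hp2 : p ≠ 2) (hp3 : p ≠ 3) :
    ∃ v : MvPolynomial (Fin 4) k, cartierTrace p 1
      ((X 0 * X 1 * X 2 * X 3 - (X 0 ^ 2 + X 1 ^ 2 + X 2 ^ 2)) ^ (p ^ 1 - 1) *
        (v * (X 0 * X 1 * X 2))) = 1 := by
  have hp : p.Prime := Fact.out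
  have h4 : p ≠ 4 := by rintro rfl; exact absurd hp (by norm_num)
  have h2 := hp.two_le
  have hne : (6 * ((p - 1).choose 3 : k)) ≠ 0 := natCast_six_mul_choose_ne_zero p hp2 hp3
  set r : k := -(6 * ((p - 1).choose 3 : k))⁻¹ with hr
  have hr1 : C r * -(6 * ((p - 1).choose 3 : MvPolynomial (Fin 4) k)) = 1 := by
    rw [show (6 * ((p - 1).choose 3 : MvPolynomial (Fin 4) k)) = C (6 * ((p - 1).choose 3 : k)) by
      rw [C_mul, map_ofNat, map_natCast], ← C_neg, ← C_mul, hr, neg_mul_neg, inv_mul_cancel₀ hne, C_1]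
  refine ⟨X 3 ^ 3 * C r, ?_⟩
  rw [show (X 3 ^ 3 * C r * (X 0 * X 1 * X 2) : MvPolynomial (Fin 4) k) =
    X 3 ^ 3 * (C r * (X 0 * X 1 * X 2)) by ring,
    cartierTrace_linear_pow_mul p 1 prod_X_mem_supported sum_X_sq_mem_supported
      (h := C r * (X 0 * X 1 * X 2))
      (mul_mem (Subalgebra.algebraMap_mem _ r) prod_X_mem_supported) (by rw [pow_one]; omega)]
  obtain ⟨t, rfl⟩ : ∃ t, p = t + 4 := ⟨p - 4, by omega⟩
  have hmod : (t + 1) % (t + 4) ^ 1 ≠ (t + 4) ^ 1 - 1 := by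
    rw [pow_one, Nat.mod_eq_of_lt (by omega)]
    omega
  have hvanish (i : Fin 4) (h : MvPolynomial (Fin 4) k) (hh : h ∈ supported k {i}ᶜ) :
      cartierTrace (t + 4) 1 (X i ^ (t + 1) * h) = 0 :=
    cartierTrace_X_pow_mul_eq_zero _ _ hh hmod
  set c : MvPolynomial (Fin 4) k := C r * -((t + 4 - 1).choose 3 : MvPolynomial (Fin 4) k) with hc
  have hcmem (s : Set (Fin 4)) : c ∈ supported k s :=
    mul_mem (Subalgebra.algebraMap_mem _ r) (neg_mem (natCast_mem _ _))
  have hc6 : 6 * c = 1 := by rw [← hr1, hc]; ring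
  clear_value c
  have hdecomp : (X 3 ^ ((t + 4) ^ 1 - 1) * ((X 0 * X 1 * X 2) ^ ((t + 4) ^ 1 - 1 - 3) *
      (-(X 0 ^ 2 + X 1 ^ 2 + X 2 ^ 2)) ^ 3 *
      (((t + 4) ^ 1 - 1).choose 3 : MvPolynomial (Fin 4) k) * (C r * (X 0 * X 1 * X 2)))) =
      ∏ i, X i ^ ((t + 4) ^ 1 - 1) +
      X 0 ^ (t + 1) * (X 1 ^ (t + 1) * X 2 ^ (t + 1) * X 3 ^ (t + 3) * c *
        (X 1 ^ 2 + X 2 ^ 2) ^ 3) +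
      X 1 ^ (t + 1) * (X 0 ^ (t + 1) * X 2 ^ (t + 1) * X 3 ^ (t + 3) * c *
        (X 0 ^ 6 + 3 * X 0 ^ 4 * X 2 ^ 2 + 3 * X 0 ^ 2 * X 2 ^ 4)) +
      X 2 ^ (t + 1) * (X 0 ^ (t + 1) * X 1 ^ (t + 1) * X 3 ^ (t + 3) * c *
        (3 * X 0 ^ 4 * X 1 ^ 2 + 3 * X 0 ^ 2 * X 1 ^ 4)) := by
    rw [Fin.prod_univ_four, show (t + 4) ^ 1 - 1 = t + 3 by simp, show t + 3 - 3 = t by omega]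
    rw [show t + 4 - 1 = t + 3 by omega] at hc
    linear_combination (X 0 * X 1 * X 2 * X 3) ^ (t + 3) * hc6 -
      (X 0 * X 1 * X 2) ^ (t + 1) * X 3 ^ (t + 3) * (X 0 ^ 2 + X 1 ^ 2 + X 2 ^ 2) ^ 3 * hc
  have hXm {i j : Fin 4} (hij : j ≠ i) (n : ℕ) :
      (X j ^ n : MvPolynomial (Fin 4) k) ∈ supported k {i}ᶜ :=
    pow_mem (X_mem_supported.2 hij) n
  have h3m (i : Fin 4) : (3 : MvPolynomial (Fin 4) k) ∈ supported k {i}ᶜ := ofNat_mem _ 3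
  rw [hdecomp, map_add, map_add, map_add, cartierTrace_prod_X_pow, hvanish, hvanish, hvanish,
    add_zero, add_zero, add_zero]
  · exact mul_mem (mul_mem (mul_mem (mul_mem (hXm (by decide) _) (hXm (by decide) _))
      (hXm (by decide) _)) (hcmem _)) (add_mem (mul_mem (mul_mem (h3m _) (hXm (by decide) _))
      (hXm (by decide) _)) (mul_mem (mul_mem (h3m _) (hXm (by decide) _)) (hXm (by decide) _)))
  · exact mul_mem (mul_mem (mul_mem (mul_mem (hXm (by decide) _) (hXm (by decide) _))
      (hXm (by decide) _)) (hcmem _)) (add_mem (add_mem (hXm (by decide) _)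
      (mul_mem (mul_mem (h3m _) (hXm (by decide) _)) (hXm (by decide) _)))
      (mul_mem (mul_mem (h3m _) (hXm (by decide) _)) (hXm (by decide) _)))
  · exact mul_mem (mul_mem (mul_mem (mul_mem (hXm (by decide) _) (hXm (by decide) _))
      (hXm (by decide) _)) (hcmem _)) (pow_mem (add_mem (hXm (by decide) _)
      (hXm (by decide) _)) _)

/-- For a nonzero polynomial `h` not involving `xᵢ` and `d * xᵢ - s` linear in `xᵢ`, some twisted
trace sends `h` to `d`. -/
lemma exists_cartierTrace_linear_pow_mul_eq {σ : Type*} [Fintype σ] {i : σ}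
    {d s h : MvPolynomial σ k} (hd : d ∈ supported k {i}ᶜ) (hs : s ∈ supported k {i}ᶜ)
    (hh : h ∈ supported k {i}ᶜ) (h0 : h ≠ 0) :
    ∃ (e : ℕ) (v : MvPolynomial σ k),
      cartierTrace p e ((d * X i - s) ^ (p ^ e - 1) * (v * h)) = d := by
  classical
  have hp : p.Prime := Fact.out
  obtain ⟨m, hm⟩ := support_nonempty.2 h0
  have hlt : ∀ n ∈ h.support, ∀ j, n j < p ^ h.totalDegree := fun n hn j =>
    ((Finsupp.le_degree j n).trans (le_totalDegree hn)).trans_lt (Nat.lt_pow_self hp.one_lt)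
  set e := h.totalDegree
  have hmi : m i = 0 := by
    by_contra hne
    exact mem_support_iff.1 hm (coeff_eq_zero_of_mem_supported_compl hh hne)
  set w := constExponent σ (p ^ e - 1) - m with hw
  have hwi : w i = p ^ e - 1 := by simp [hw, hmi]
  set u : MvPolynomial σ k := monomial (w.erase i) (coeff m h)⁻¹ with hu
  have hu_mem : u ∈ supported k {i}ᶜ := by
    rw [mem_supported]
    intro j hj hji
    obtain ⟨n, hn, hjn⟩ := (mem_vars_iff_mem_support j).1 hj
    obtain rfl := Finset.mem_singleton.1 (support_monomial_subset hn)
    rw [Set.mem_singleton_iff] at hji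
    simp [hji] at hjn
  have hXu : X i ^ (p ^ e - 1) * u = monomial w (coeff m h)⁻¹ := by
    rw [hu, X_pow_eq_monomial, monomial_mul, one_mul, ← hwi, Finsupp.single_add_erase]
  refine ⟨e, d * u, ?_⟩
  have key := cartierTrace_linear_pow_mul p e hd hs (mul_mem (mul_mem hd hu_mem) hh)
    (Nat.zero_le _)
  rw [pow_zero, one_mul] at key
  rw [key]
  have hpow : d ^ p ^ e = d ^ (p ^ e - 1) * d := by
    rw [← pow_succ, Nat.sub_add_cancel (Nat.pos_of_ne_zero (fact_prime_pow_ne_zero p e))]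
  have hrw : X i ^ (p ^ e - 1) * (d ^ (p ^ e - 1 - 0) * (-s) ^ 0 *
      ((p ^ e - 1).choose 0 : MvPolynomial σ k) * (d * u * h)) =
      d ^ p ^ e * (monomial w (coeff m h)⁻¹ * h) := by
    rw [← hXu, hpow, Nat.choose_zero_right, Nat.cast_one, Nat.sub_zero]
    ring
  rw [hrw, cartierTrace_pow_mul, cartierTrace_monomial_sub_mul p e hlt (hlt m hm),
    inv_mul_cancel₀ (mem_support_iff.1 hm), map_one, C_1, mul_one]

end Markov

open MvPolynomial in
/-- The Markov upper cluster algebra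
`U = k[x₁,x₂,x₃,M]/(x₁x₂x₃M − x₁² − x₂² − x₃²)` over a perfect field of
characteristic `p ∉ {2,3}` is strongly `F`-regular. -/
theorem markov_upper_cluster_algebra_stronglyFRegular
    (k : Type*) [Field k] [PerfectField k] (p : ℕ) [Fact p.Prime] [CharP k p]
    (hp2 : p ≠ 2) (hp3 : p ≠ 3) :
    StronglyFRegular
      (MvPolynomial (Fin 4) k ⧸
        Ideal.span {(X 0 * X 1 * X 2 * X 3 - X 0 ^ 2 - X 1 ^ 2 - X 2 ^ 2 :
          MvPolynomial (Fin 4) k)}) p := by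
  rw [show (X 0 * X 1 * X 2 * X 3 - X 0 ^ 2 - X 1 ^ 2 - X 2 ^ 2 : MvPolynomial (Fin 4) k) =
    X 0 * X 1 * X 2 * X 3 - (X 0 ^ 2 + X 1 ^ 2 + X 2 ^ 2) by ring]
  refine StronglyFRegular.of_element (Ideal.Quotient.mk _ (X 0 * X 1 * X 2)) ?_ fun c hc => ?_
  · obtain ⟨v, hv⟩ := cartierTrace_markov (k := k) p hp2 hp3
    obtain ⟨χ, hχ, hχv⟩ := exists_isPeLinear_quotient_span_singleton p 1
      (X 0 * X 1 * X 2 * X 3 - (X 0 ^ 2 + X 1 ^ 2 + X 2 ^ 2)) v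
    exact ⟨1, le_rfl, χ, hχ, by rw [hχv, hv, map_one]⟩
  · obtain ⟨g, rfl⟩ := Ideal.Quotient.mk_surjective c
    obtain ⟨n, h, hh, hdvd⟩ :=
      exists_dvd_pow_mul_sub_of_linear (prod_X_mem_supported (k := k)) sum_X_sq_mem_supported g
    have h0 : h ≠ 0 := by
      rintro rfl
      rw [sub_zero] at hdvd
      exact hc (Ideal.Quotient.eq_zero_iff_mem.2
        (Ideal.mem_span_singleton.2 (markov_dvd_of_dvd_prod_X_pow_mul hdvd)))
    obtain ⟨e, v, hv⟩ := exists_cartierTrace_linear_pow_mul_eq p prod_X_mem_supported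
      sum_X_sq_mem_supported hh h0
    obtain ⟨ψ, hψ, hψv⟩ := exists_isPeLinear_quotient_span_singleton p e
      (X 0 * X 1 * X 2 * X 3 - (X 0 ^ 2 + X 1 ^ 2 + X 2 ^ 2)) v
    refine ⟨e, _, hψ.comp_mul_left (Ideal.Quotient.mk _ ((X 0 * X 1 * X 2) ^ n)), ?_⟩
    have hmk := Ideal.Quotient.eq.2 (Ideal.mem_span_singleton.2 hdvd)
    rw [← map_mul, hmk, hψv, hv]
end

section
/- Let k be a perfect field of characteristic p > 0 and let a ≥ 3 be an integer. Let U = k[x₁,x₂,x₃,M]/(x₁x₂x₃M − x₁^a − x₂^a − x₃^a). Then U is not strongly F-regular; in fact the class c of x₁ in U is nonzero, and for every integer e ≥ 1 and every p^{-e}-linear map ψ on U one has ψ(c) ≠ 1. -/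
/-- In a ring where `x ^ a = x * y * z * m - y ^ a - z ^ a`, monomials of large weighted degree
(weights `1, 1, 1, a - 3`) lie in the ideal generated by `y ^ q`, `z ^ q` and `m ^ q`. -/
theorem monomial_mem_span_pow_of_relation {R : Type*} [CommRing R] {x y z m : R} {a q : ℕ}
    (ha : 3 ≤ a) (hq : 0 < q) (h : x ^ a = x * y * z * m - y ^ a - z ^ a) (i : ℕ) :
    ∀ j k l : ℕ, q * (a - 1) < i + j + k + (a - 3) * l →
      x ^ i * y ^ j * z ^ k * m ^ l ∈ Ideal.span {y ^ q, z ^ q, m ^ q} := by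
  induction i using Nat.strong_induction_on with
  | _ i ih =>
    intro j k l hd
    by_cases hj : q ≤ j
    · refine Ideal.mem_of_dvd _ (a := y ^ q) ?_ (Ideal.subset_span (by simp))
      exact Dvd.dvd.mul_right (Dvd.dvd.mul_right (Dvd.dvd.mul_left (pow_dvd_pow y hj) _) _) _
    by_cases hk : q ≤ k
    · refine Ideal.mem_of_dvd _ (a := z ^ q) ?_ (Ideal.subset_span (by simp))
      exact Dvd.dvd.mul_right (Dvd.dvd.mul_left (pow_dvd_pow z hk) _) _
    by_cases hl : q ≤ l
    · refine Ideal.mem_of_dvd _ (a := m ^ q) ?_ (Ideal.subset_span (by simp))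
      exact Dvd.dvd.mul_left (pow_dvd_pow m hl) _
    obtain ⟨b, rfl⟩ := Nat.exists_eq_add_of_le' ha
    obtain ⟨r, rfl⟩ := Nat.exists_eq_add_of_le' hq
    simp only [Nat.add_sub_cancel, show b + 3 - 1 = b + 2 by omega] at hd ih
    have hi : b + 3 ≤ i := by
      by_contra hi
      have : b * l ≤ b * r := Nat.mul_le_mul_left b (by omega)
      nlinarith
    obtain ⟨n, rfl⟩ := Nat.exists_eq_add_of_le' hi
    have h₁ := ih (n + 1) (by omega) (j + 1) (k + 1) (l + 1) (by linarith)
    have h₂ := ih n (by omega) (j + (b + 3)) k l (by linarith)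
    have h₃ := ih n (by omega) j (k + (b + 3)) l (by linarith)
    convert sub_mem (sub_mem h₁ h₂) h₃ using 1
    rw [pow_add x n, h]
    ring

/-- A `p^{-e}`-linear map carries the Frobenius power of an ideal into the ideal. -/
theorem IsPeLinear.map_mem_span {R : Type*} [CommRing R] {q : ℕ} {ψ : R → R}
    (hψ : IsPeLinear q ψ) {s : Set R} {c : R} (hc : c ∈ Ideal.span ((· ^ q) '' s)) :
    ψ c ∈ Ideal.span s := by
  have h_zero : ψ 0 = 0 := by simpa using hψ.1 0 0
  refine Submodule.span_induction
    (p := fun c _ => ∀ r, ψ (r * c) ∈ Ideal.span s) ?_ ?_ ?_ ?_ hc 1 |> fun h => by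
      simpa using h
  · rintro _ ⟨t, ht, rfl⟩ r
    rw [mul_comm, hψ.2]
    exact Ideal.mul_mem_right _ _ (Ideal.subset_span ht)
  · intro r
    simp [h_zero]
  · intro c d _ _ hc hd r
    rw [mul_add, hψ.1]
    exact add_mem (hc r) (hd r)
  · intro r' c _ hc r
    rw [smul_eq_mul, ← mul_assoc]
    exact hc _

open MvPolynomial in
/-- In the generalized Markov algebra, `x₁ ^ (a - 1)` is not in the ideal `(x₂, x₃, M)`. -/
theorem generalized_markov_pow_notMem_span (k : Type*) [Field k] (a : ℕ) (ha : 3 ≤ a) :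
    let π := Ideal.Quotient.mk (Ideal.span {(X 0 * X 1 * X 2 * X 3 - X 0 ^ a - X 1 ^ a - X 2 ^ a :
      MvPolynomial (Fin 4) k)})
    π (X 0) ^ (a - 1) ∉ Ideal.span {π (X 1), π (X 2), π (X 3)} := by
  intro π hmem
  let J : Ideal (Polynomial k) := Ideal.span {Polynomial.X ^ a}
  let g : MvPolynomial (Fin 4) k →+* Polynomial k ⧸ J :=
    (Ideal.Quotient.mk J).comp
      (aeval (R := k) ![(Polynomial.X : Polynomial k), 0, 0, 0]).toRingHom
  have hg : ∀ f ∈ Ideal.span {(X 0 * X 1 * X 2 * X 3 - X 0 ^ a - X 1 ^ a - X 2 ^ a :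
      MvPolynomial (Fin 4) k)}, g f = 0 := by
    intro f hf
    refine (Ideal.span_le (I := RingHom.ker g)).2 ?_ hf
    have : a ≠ 0 := by omega
    simp [g, J, RingHom.mem_ker, this]
  let G := Ideal.Quotient.lift _ g hg
  have hG : ∀ f, G (π f) = g f := fun f => Ideal.Quotient.lift_mk _ _ _
  have h_zero : G (π (X 0) ^ (a - 1)) = 0 := by
    refine (Ideal.span_le (I := RingHom.ker G)).2 ?_ hmem
    rintro _ (rfl | rfl | rfl) <;> simp [RingHom.mem_ker, hG, g]
  rw [map_pow, hG] at h_zero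
  simp only [g, J, RingHom.comp_apply, AlgHom.toRingHom_eq_coe, RingHom.coe_coe, aeval_X,
    Matrix.cons_val_zero, ← map_pow, Ideal.Quotient.eq_zero_iff_mem,
    Ideal.mem_span_singleton] at h_zero
  have := (pow_dvd_pow_iff Polynomial.X_ne_zero Polynomial.not_isUnit_X).1 h_zero
  omega

open MvPolynomial in
/-- The generalized Markov upper cluster algebra
`U = k[x₁,x₂,x₃,M]/(x₁x₂x₃M − x₁^a − x₂^a − x₃^a)` with `a ≥ 3`, over a perfect field of
positive characteristic `p`, is not strongly `F`-regular: the class `c` of `x₁` is nonzero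
and no `p^{-e}`-linear map sends `c` to `1`. -/
theorem generalized_markov_not_stronglyFRegular
    (k : Type*) [Field k] [PerfectField k] (p : ℕ) [Fact p.Prime] [CharP k p]
    (a : ℕ) (ha : 3 ≤ a) :
    (Ideal.Quotient.mk
        (Ideal.span {(X 0 * X 1 * X 2 * X 3 - X 0 ^ a - X 1 ^ a - X 2 ^ a :
          MvPolynomial (Fin 4) k)}) (X 0) ≠ 0) ∧
      ∀ e : ℕ, 1 ≤ e →
        ∀ ψ : (MvPolynomial (Fin 4) k ⧸
            Ideal.span {(X 0 * X 1 * X 2 * X 3 - X 0 ^ a - X 1 ^ a - X 2 ^ a :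
              MvPolynomial (Fin 4) k)}) →
          (MvPolynomial (Fin 4) k ⧸
            Ideal.span {(X 0 * X 1 * X 2 * X 3 - X 0 ^ a - X 1 ^ a - X 2 ^ a :
              MvPolynomial (Fin 4) k)}),
          IsPeLinear (p ^ e) ψ →
            ψ (Ideal.Quotient.mk
              (Ideal.span {(X 0 * X 1 * X 2 * X 3 - X 0 ^ a - X 1 ^ a - X 2 ^ a :
                MvPolynomial (Fin 4) k)}) (X 0)) ≠ 1 := by
  have h_notMem := generalized_markov_pow_notMem_span k a ha
  set π := Ideal.Quotient.mk (Ideal.span {(X 0 * X 1 * X 2 * X 3 - X 0 ^ a - X 1 ^ a - X 2 ^ a :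
    MvPolynomial (Fin 4) k)})
  refine ⟨fun h => h_notMem ?_, fun e _ ψ hψ h_one => h_notMem ?_⟩
  · rw [h, zero_pow (by omega)]
    exact zero_mem _
  have h_rel : π (X 0) ^ a =
      π (X 0) * π (X 1) * π (X 2) * π (X 3) - π (X 1) ^ a - π (X 2) ^ a := by
    have : π (X 0 * X 1 * X 2 * X 3 - X 0 ^ a - X 1 ^ a - X 2 ^ a) = 0 :=
      Ideal.Quotient.eq_zero_iff_mem.2 (Ideal.subset_span rfl)
    simp only [map_sub, map_mul, map_pow] at this
    linear_combination -this
  have hq : 0 < p ^ e := pow_pos (Fact.out : p.Prime).pos e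
  have h_mem := monomial_mem_span_pow_of_relation ha hq h_rel
    ((a - 1) * p ^ e + 1) 0 0 0 (by rw [mul_comm]; omega)
  have h_map : ψ ((π (X 0) ^ (a - 1)) ^ p ^ e * π (X 0)) ∈
      Ideal.span {π (X 1), π (X 2), π (X 3)} := by
    refine hψ.map_mem_span ?_
    simpa [Set.image_insert_eq, pow_succ, pow_mul] using h_mem
  rwa [hψ.2, h_one, mul_one] at h_map
end

section
/- Let k be a perfect field of characteristic p, let n ≥ 1, and let F = k(x₁,…,xₙ) be the field of rational functions in n variables over k. Let φ : F → F be a p^{-1}-linear map such that for every a ∈ ℤⁿ, φ(x^a) = x^{a/p} if p divides every component of a, and φ(x^a) = 0 otherwise. Let m⁺ and m⁻ be monomials in the variables x₂,…,xₙ (not involving x₁) with disjoint supports and not both equal to 1, and set x₁' := (m⁺ + m⁻)/x₁ ∈ F. Then for every α ∈ ℤⁿ, φ(x₁'^{α₁}·x₂^{α₂}⋯xₙ^{αₙ}) = x₁'^{α₁/p}·x₂^{α₂/p}⋯xₙ^{αₙ/p} if p divides every component of α, and φ(x₁'^{α₁}·x₂^{α₂}⋯xₙ^{αₙ}) = 0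 otherwise. (Hence the standard splitting of F with respect to the cluster {x₁,…,xₙ} coincides with the standard splitting with respect to the mutated cluster {x₁',x₂,…,xₙ}.) -/
/-- An additive map that kills every monomial whose exponent at `i₀` is not divisible by `p` kills
every product of a monomial not involving `x i₀` with an `r`-th power of
`(∏ x ^ u + ∏ x ^ v) / x i₀`, where `p ∤ r` and `u`, `v` vanish at `i₀`. -/
theorem map_binomial_div_pow_mul_eq_zero {ι K : Type*} [Fintype ι] [Field K]
    {x : ι → K} (hx : ∀ i, x i ≠ 0) (i₀ : ι) {p : ℕ} (f : K →+ K)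
    (hf : ∀ a : ι → ℤ, ¬ (p : ℤ) ∣ a i₀ → f (∏ i, x i ^ a i) = 0)
    {u v : ι → ℕ} (hu : u i₀ = 0) (hv : v i₀ = 0) {r : ℕ} (hr : ¬ p ∣ r)
    {b : ι → ℤ} (hb : b i₀ = 0) :
    f (((∏ i, x i ^ (u i : ℤ) + ∏ i, x i ^ (v i : ℤ)) / x i₀) ^ r * ∏ i, x i ^ b i) = 0 := by
  classical
  have expand : ((∏ i, x i ^ (u i : ℤ) + ∏ i, x i ^ (v i : ℤ)) / x i₀) ^ r * ∏ i, x i ^ b i =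
      ∑ j ∈ Finset.range (r + 1), r.choose j • ∏ i, x i ^
        ((u i : ℤ) * j + (v i : ℤ) * ((r - j : ℕ) : ℤ) + b i + (Pi.single i₀ (-(r : ℤ)) : ι → ℤ) i) := by
    have hsingle : ∏ i, x i ^ (Pi.single i₀ (-(r : ℤ)) : ι → ℤ) i = (x i₀ ^ r)⁻¹ := by
      rw [Fintype.prod_eq_single i₀ fun i hi => by simp [hi]]
      simp
    rw [div_pow, add_pow, Finset.sum_div, Finset.sum_mul]
    refine Finset.sum_congr rfl fun j _ => ?_
    simp only [zpow_add₀ (hx _), zpow_mul, zpow_natCast, Finset.prod_mul_distrib, hsingle,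
      Finset.prod_pow, nsmul_eq_mul]
    ring
  rw [expand, map_sum]
  refine Finset.sum_eq_zero fun j _ => ?_
  rw [map_nsmul, hf, nsmul_zero]
  simpa [hu, hv, hb, Int.natCast_dvd_natCast] using hr

/-- A standard splitting for the family `x` is also one for the family obtained by replacing
`x i₀` by the binomial quotient `(∏ x ^ u + ∏ x ^ v) / x i₀`. -/
theorem IsPeLinear.map_mutated_monomial {ι K : Type*} [Fintype ι] [DecidableEq ι] [Field K]
    {x : ι → K} (hx : ∀ i, x i ≠ 0) (i₀ : ι) {p : ℕ} (hp : p ≠ 0) {φ : K → K}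
    (hφ : IsPeLinear p φ)
    (hmon : ∀ a : ι → ℤ,
      ((∀ i, (p : ℤ) ∣ a i) → φ (∏ i, x i ^ a i) = ∏ i, x i ^ (a i / p)) ∧
      (¬ (∀ i, (p : ℤ) ∣ a i) → φ (∏ i, x i ^ a i) = 0))
    {u v : ι → ℕ} (hu : u i₀ = 0) (hv : v i₀ = 0) (α : ι → ℤ) :
    ((∀ i, (p : ℤ) ∣ α i) →
      φ (((∏ i, x i ^ (u i : ℤ) + ∏ i, x i ^ (v i : ℤ)) / x i₀) ^ α i₀ *
          ∏ i ∈ Finset.univ.erase i₀, x i ^ α i) =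
        ((∏ i, x i ^ (u i : ℤ) + ∏ i, x i ^ (v i : ℤ)) / x i₀) ^ (α i₀ / p) *
          ∏ i ∈ Finset.univ.erase i₀, x i ^ (α i / p)) ∧
    (¬ (∀ i, (p : ℤ) ∣ α i) →
      φ (((∏ i, x i ^ (u i : ℤ) + ∏ i, x i ^ (v i : ℤ)) / x i₀) ^ α i₀ *
          ∏ i ∈ Finset.univ.erase i₀, x i ^ α i) = 0) := by
  have erase_prod (a : ι → ℤ) :
      ∏ i ∈ Finset.univ.erase i₀, x i ^ a i = ∏ i, x i ^ Function.update a i₀ 0 i := by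
    rw [← Finset.mul_prod_erase Finset.univ _ (Finset.mem_univ i₀), Function.update_self,
      zpow_zero, one_mul]
    exact Finset.prod_congr rfl fun i hi => by
      rw [Function.update_of_ne (Finset.ne_of_mem_erase hi)]
  have dvd_update (h : (p : ℤ) ∣ α i₀) :
      (∀ i, (p : ℤ) ∣ Function.update α i₀ 0 i) ↔ ∀ i, (p : ℤ) ∣ α i := by
    refine forall_congr' fun i => ?_
    obtain rfl | hi := eq_or_ne i i₀
    · simp [h]
    · rw [Function.update_of_ne hi]
  have update_div : (fun i => Function.update α i₀ 0 i / (p : ℤ)) =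
      Function.update (fun i => α i / (p : ℤ)) i₀ 0 := by
    funext i
    obtain rfl | hi := eq_or_ne i i₀ <;> simp [*]
  have pull (z w : K) (h : (p : ℤ) ∣ α i₀) : φ (z ^ α i₀ * w) = z ^ (α i₀ / p) * φ w := by
    rw [← hφ.2, ← zpow_natCast, ← zpow_mul, Int.ediv_mul_cancel h]
  constructor
  · intro h
    rw [pull _ _ (h i₀), erase_prod, (hmon _).1 ((dvd_update (h i₀)).2 h),
      erase_prod fun i => α i / p]
    simp only [congrFun update_div]
  · intro h
    by_cases h₀ : (p : ℤ) ∣ α i₀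
    · rw [pull _ _ h₀, erase_prod, (hmon _).2 (mt (dvd_update h₀).1 h), mul_zero]
    obtain ⟨r, hr⟩ := Int.eq_ofNat_of_zero_le (Int.emod_nonneg (α i₀) (Nat.cast_ne_zero.2 hp))
    have hdecomp : α i₀ = α i₀ / p * p + r := by rw [← hr, Int.ediv_mul_add_emod]
    have hpr : ¬ p ∣ r := fun hd => h₀ <| by
      rw [hdecomp]
      exact dvd_add (dvd_mul_left _ _) (Int.natCast_dvd_natCast.2 hd)
    have hα : α i₀ ≠ 0 := fun h => h₀ (h ▸ dvd_zero _)
    rw [hdecomp, zpow_add' (.inr (.inl (hdecomp ▸ hα))), zpow_mul, zpow_natCast, zpow_natCast,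
      mul_assoc, hφ.2, erase_prod]
    have hvanish := map_binomial_div_pow_mul_eq_zero hx i₀ (AddMonoidHom.mk' φ hφ.1)
      (fun a ha => (hmon a).2 fun h => ha (h i₀)) hu hv hpr (Function.update_self i₀ 0 α)
    rw [AddMonoidHom.mk'_apply] at hvanish
    rw [hvanish, mul_zero]

open MvPolynomial in
/-- The standard splitting of `F = k(x₁,…,xₙ)` with respect to the cluster `{x₁,…,xₙ}`
is also the standard splitting with respect to the mutated cluster `{x₁',x₂,…,xₙ}`,
where `x₁' = (m⁺ + m⁻)/x₁` for monomials `m⁺, m⁻` in `x₂,…,xₙ` with disjoint supports,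
not both equal to `1`. -/
theorem standard_splitting_invariant_under_mutation
    (k : Type*) [Field k] [PerfectField k] (p : ℕ) [Fact p.Prime] [CharP k p]
    (n : ℕ) (hn : 1 ≤ n)
    (φ : FractionRing (MvPolynomial (Fin n) k) → FractionRing (MvPolynomial (Fin n) k))
    (hφ : IsPeLinear (p ^ 1) φ)
    (hφmon : ∀ a : Fin n → ℤ,
      ((∀ i, (p : ℤ) ∣ a i) →
        φ (∏ i, (algebraMap (MvPolynomial (Fin n) k) _ (X i)) ^ a i) =
          ∏ i, (algebraMap (MvPolynomial (Fin n) k) _ (X i)) ^ (a i / p)) ∧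
      (¬ (∀ i, (p : ℤ) ∣ a i) →
        φ (∏ i, (algebraMap (MvPolynomial (Fin n) k) _ (X i)) ^ a i) = 0))
    (u v : Fin n → ℕ) (hu0 : u ⟨0, hn⟩ = 0) (hv0 : v ⟨0, hn⟩ = 0)
    (hdisj : ∀ i, u i = 0 ∨ v i = 0) (hnontriv : u ≠ 0 ∨ v ≠ 0) :
    ∀ α : Fin n → ℤ,
      ((∀ i, (p : ℤ) ∣ α i) →
        φ ((((∏ i, (algebraMap (MvPolynomial (Fin n) k) _ (X i)) ^ (u i : ℤ)) +
              ∏ i, (algebraMap (MvPolynomial (Fin n) k) _ (X i)) ^ (v i : ℤ)) /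
            algebraMap (MvPolynomial (Fin n) k) _ (X ⟨0, hn⟩)) ^ (α ⟨0, hn⟩) *
           ∏ i ∈ Finset.univ.erase ⟨0, hn⟩,
             (algebraMap (MvPolynomial (Fin n) k) _ (X i)) ^ (α i)) =
          (((∏ i, (algebraMap (MvPolynomial (Fin n) k) _ (X i)) ^ (u i : ℤ)) +
              ∏ i, (algebraMap (MvPolynomial (Fin n) k) _ (X i)) ^ (v i : ℤ)) /
            algebraMap (MvPolynomial (Fin n) k) _ (X ⟨0, hn⟩)) ^ (α ⟨0, hn⟩ / p) *
           ∏ i ∈ Finset.univ.erase ⟨0, hn⟩,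
             (algebraMap (MvPolynomial (Fin n) k) _ (X i)) ^ (α i / p)) ∧
      (¬ (∀ i, (p : ℤ) ∣ α i) →
        φ ((((∏ i, (algebraMap (MvPolynomial (Fin n) k) _ (X i)) ^ (u i : ℤ)) +
              ∏ i, (algebraMap (MvPolynomial (Fin n) k) _ (X i)) ^ (v i : ℤ)) /
            algebraMap (MvPolynomial (Fin n) k) _ (X ⟨0, hn⟩)) ^ (α ⟨0, hn⟩) *
           ∏ i ∈ Finset.univ.erase ⟨0, hn⟩,
             (algebraMap (MvPolynomial (Fin n) k) _ (X i)) ^ (α i)) = 0) := by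
  intro α
  rw [pow_one] at hφ
  have hx (i : Fin n) : algebraMap (MvPolynomial (Fin n) k)
      (FractionRing (MvPolynomial (Fin n) k)) (X i) ≠ 0 :=
    (map_ne_zero_iff _ (IsFractionRing.injective _ _)).2 (X_ne_zero i)
  exact IsPeLinear.map_mutated_monomial hx ⟨0, hn⟩ (Fact.out : p.Prime).ne_zero hφ hφmon
    hu0 hv0 α
end

section
/- Let k be a perfect field of characteristic p and let L = k[x₁^{±1},…,xₙ^{±1}] be the Laurent polynomial ring in n variables over k, with standard splitting φ. Then φ freely generates the module of p^{-1}-linear maps on L: for every p^{-1}-linear map ψ on L there exists a unique s ∈ L such that ψ(b) = φ(s·b) for all b ∈ L. -/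
namespace IsPeLinear

section CommRing

variable {R : Type*} [CommRing R] {q : ℕ} {ψ : R → R}

theorem map_zero (h : IsPeLinear q ψ) : ψ 0 = 0 := by
  simpa using h.1 0 0

theorem map_sum (h : IsPeLinear q ψ) {ι : Type*} (t : Finset ι) (f : ι → R) :
    ψ (∑ i ∈ t, f i) = ∑ i ∈ t, ψ (f i) :=
  _root_.map_sum (AddMonoidHom.mk' ψ h.1) f t

theorem map_sub (h : IsPeLinear q ψ) (a b : R) : ψ (a - b) = ψ a - ψ b :=
  _root_.map_sub (AddMonoidHom.mk' ψ h.1) a b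

theorem comp_mul_left_s4 (h : IsPeLinear q ψ) (s : R) : IsPeLinear q fun b => ψ (s * b) := by
  refine ⟨fun a b => ?_, fun a b => ?_⟩
  · simp only [mul_add, h.1]
  · simp only [mul_left_comm s, h.2]

end CommRing

variable {k : Type*} [Field k] {p n : ℕ}

/-- Over a perfect field, a `p^{-1}`-linear map on Laurent polynomials is determined by its values
on the monomials with exponents in `[0, p)`. -/
theorem ext_of_digits [PerfectField k] [Fact p.Prime] [CharP k p]
    {ψ χ : AddMonoidAlgebra k (Fin n → ℤ) → AddMonoidAlgebra k (Fin n → ℤ)}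
    (hψ : IsPeLinear p ψ) (hχ : IsPeLinear p χ)
    (h : ∀ d : Fin n → Fin p, ψ (AddMonoidAlgebra.single (fun i => ((d i : ℕ) : ℤ)) 1) =
      χ (AddMonoidAlgebra.single (fun i => ((d i : ℕ) : ℤ)) 1)) (b) : ψ b = χ b := by
  have hp : (0 : ℤ) < p := by exact_mod_cast (Fact.out : p.Prime).pos
  have : ExpChar k p := ExpChar.prime Fact.out
  induction b using AddMonoidAlgebra.induction_linear with
  | zero => rw [hψ.map_zero, hχ.map_zero]
  | add f g hf hg => rw [hψ.1, hχ.1, hf, hg]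
  | single a c =>
    obtain ⟨c, rfl⟩ := surjective_frobenius k p c
    have hlt (i : Fin n) : (a i % p).toNat < p := by
      have := Int.emod_nonneg (a i) hp.ne'
      have := Int.emod_lt_of_pos (a i) hp
      lia
    have key : (AddMonoidAlgebra.single a (frobenius k p c) :
        AddMonoidAlgebra k (Fin n → ℤ)) =
        AddMonoidAlgebra.single (fun i => a i / p) c ^ p *
          AddMonoidAlgebra.single
            (fun i => (((⟨(a i % p).toNat, hlt i⟩ : Fin p) : ℕ) : ℤ)) 1 := by
      rw [AddMonoidAlgebra.single_pow, AddMonoidAlgebra.single_mul_single, mul_one,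
        frobenius_def]
      congr 1
      ext i
      simp [Int.emod_nonneg (a i) hp.ne', Int.mul_ediv_add_emod]
    rw [key, hψ.2, hχ.2, h fun i => ⟨(a i % p).toNat, hlt i⟩]

/-- The standard splitting takes a `p`-th root of the constant coefficient. -/
theorem coeff_zero_pow_of_standard [PerfectField k] [Fact p.Prime] [CharP k p]
    {φ : AddMonoidAlgebra k (Fin n → ℤ) → AddMonoidAlgebra k (Fin n → ℤ)}
    (hφ : IsPeLinear p φ)
    (hdvd : ∀ a : Fin n → ℤ, (∀ i, (p : ℤ) ∣ a i) →
      φ (AddMonoidAlgebra.single a 1) = AddMonoidAlgebra.single (fun i => a i / p) 1)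
    (hndvd : ∀ a : Fin n → ℤ, ¬ (∀ i, (p : ℤ) ∣ a i) → φ (AddMonoidAlgebra.single a 1) = 0)
    (f) : (φ f).coeff 0 ^ p = f.coeff 0 := by
  have hp0 : p ≠ 0 := (Fact.out : p.Prime).ne_zero
  have : ExpChar k p := ExpChar.prime Fact.out
  induction f using AddMonoidAlgebra.induction_linear with
  | zero => simp [hφ.map_zero, hp0]
  | add f g hf hg =>
    simp [hφ.1, add_pow_char, hf, hg]
  | single a c =>
    obtain ⟨c, rfl⟩ := surjective_frobenius k p c
    have key : (AddMonoidAlgebra.single a (frobenius k p c) :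
        AddMonoidAlgebra k (Fin n → ℤ)) =
        AddMonoidAlgebra.single 0 c ^ p * AddMonoidAlgebra.single a 1 := by
      simp [AddMonoidAlgebra.single_pow, AddMonoidAlgebra.single_mul_single, frobenius_def]
    rw [key, hφ.2, ← key]
    by_cases ha : ∀ i, (p : ℤ) ∣ a i
    · have hz : (fun i => a i / (p : ℤ)) = 0 ↔ a = 0 := by
        simp only [funext_iff, Pi.zero_apply]
        refine forall_congr' fun i => ?_
        rw [Int.ediv_eq_iff_eq_mul_left (by exact_mod_cast hp0) (ha i), zero_mul]
      rw [hdvd a ha, AddMonoidAlgebra.single_mul_single]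
      simp only [AddMonoidAlgebra.coeff_single, Finsupp.single_apply, zero_add, mul_one, hz]
      split_ifs <;> simp [frobenius_def, hp0]
    · have h0 : a ≠ 0 := by rintro rfl; simp at ha
      simp [hndvd a ha, hp0, h0]

end IsPeLinear

/-- Distinct digit vectors with entries in `[0, p)` are incongruent modulo `p`. -/
theorem forall_dvd_digit_sub_iff {p n : ℕ} (d e : Fin n → Fin p) :
    (∀ i, (p : ℤ) ∣ ((e i : ℕ) : ℤ) - ((d i : ℕ) : ℤ)) ↔ d = e := by
  refine ⟨fun h => funext fun i => Fin.ext ?_, by rintro rfl; simp⟩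
  exact (Nat.modEq_iff_dvd.2 (h i)).eq_of_lt_of_lt (d i).2 (e i).2

/-- The standard splitting `φ` of the Laurent polynomial ring
`L = k[x₁^{±1},…,xₙ^{±1}]` (the monoid algebra of `ℤⁿ` over `k`) freely generates the
module of `p^{-1}`-linear maps on `L`: every `p^{-1}`-linear map `ψ` is of the form
`ψ = φ(s·-)` for a unique `s ∈ L`. -/
theorem standard_splitting_generates_pInverseLinear_maps
    (k : Type*) [Field k] [PerfectField k] (p : ℕ) [Fact p.Prime] [CharP k p] (n : ℕ)
    (φ : AddMonoidAlgebra k (Fin n → ℤ) → AddMonoidAlgebra k (Fin n → ℤ))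
    (hφ : IsPeLinear (p ^ 1) φ)
    (hφmon : ∀ a : Fin n → ℤ,
      ((∀ i, (p : ℤ) ∣ a i) →
        φ (AddMonoidAlgebra.single a 1) =
          AddMonoidAlgebra.single (fun i => a i / p) 1) ∧
      (¬ (∀ i, (p : ℤ) ∣ a i) → φ (AddMonoidAlgebra.single a 1) = 0)) :
    ∀ ψ : AddMonoidAlgebra k (Fin n → ℤ) → AddMonoidAlgebra k (Fin n → ℤ),
      IsPeLinear (p ^ 1) ψ →
        ∃! s : AddMonoidAlgebra k (Fin n → ℤ), ∀ b, ψ b = φ (s * b) := by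
  rw [pow_one] at hφ ⊢
  intro ψ hψ
  refine existsUnique_of_exists_of_unique ⟨∑ d : Fin n → Fin p,
    ψ (AddMonoidAlgebra.single (fun i => ((d i : ℕ) : ℤ)) 1) ^ p *
      AddMonoidAlgebra.single (fun i => -((d i : ℕ) : ℤ)) 1, ?_⟩ fun s t hs ht => ?_
  · refine hψ.ext_of_digits (hφ.comp_mul_left_s4 _) fun e => ?_
    have hterm (d : Fin n → Fin p) :
        φ (AddMonoidAlgebra.single (fun i => -((d i : ℕ) : ℤ)) 1 *
          AddMonoidAlgebra.single (fun i => ((e i : ℕ) : ℤ)) 1) = if d = e then 1 else 0 := by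
      have hsum : (fun i => -((d i : ℕ) : ℤ)) + (fun i => ((e i : ℕ) : ℤ)) =
          fun i => ((e i : ℕ) : ℤ) - ((d i : ℕ) : ℤ) := by
        ext i
        simp [sub_eq_neg_add]
      rw [AddMonoidAlgebra.single_mul_single, mul_one, hsum]
      split_ifs with h
      · rw [(hφmon _).1 ((forall_dvd_digit_sub_iff d e).2 h)]
        subst h
        simp [AddMonoidAlgebra.one_def, Pi.zero_def]
      · exact (hφmon _).2 fun h' => h ((forall_dvd_digit_sub_iff d e).1 h')
    simp only [Finset.sum_mul, hφ.map_sum, mul_assoc, hφ.2, hterm]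
    simp
  · rw [← sub_eq_zero]
    ext a
    have hzero : φ ((s - t) * AddMonoidAlgebra.single (-a) 1) = 0 := by
      rw [sub_mul, hφ.map_sub, ← hs, ← ht, sub_self]
    have hcoeff := hφ.coeff_zero_pow_of_standard (fun a => (hφmon a).1) (fun a => (hφmon a).2)
      ((s - t) * AddMonoidAlgebra.single (-a) 1)
    rw [hzero, AddMonoidAlgebra.coeff_mul_single_eq_coeff_mul (m₂ := a)
      fun b _ => by rw [← sub_eq_add_neg, sub_eq_zero]] at hcoeff
    simpa [(Fact.out : p.Prime).ne_zero] using hcoeff.symm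
end

section
/- Fix a field k, an integer n ≥ 1, and a quiver without loops or directed 2-cycles on vertices {1,…,n}, encoded by a matrix b : {1,…,n}² → ℕ (where b(i,j) is the number of arrows from i to j) with b(i,i) = 0 for all i and min(b(i,j), b(j,i)) = 0 for all i,j. For each i set pᵢ⁺ = ∏_j x_j^{b(j,i)} and pᵢ⁻ = ∏_j x_j^{b(i,j)} in k[x₁,…,xₙ], and xᵢ' = (pᵢ⁺ + pᵢ⁻)/xᵢ ∈ k(x₁,…,xₙ). Let π : k[x₁,…,xₙ,y₁,…,yₙ] → k(x₁,…,xₙ) be the k-algebra homomorphism with π(xᵢ) = xᵢ and π(yᵢ) = xᵢ', and let I = ⟨x₁y₁ − p₁⁺ − p₁⁻, …, xₙyₙ − pₙ⁺ − pₙ⁻⟩. Then the kernel L of π is a minimal prime over I: L is a prime ideal containing I, and there is no prime ideal Q with I ⊆ Q ⊊ L. -/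
open MvPolynomial in
/-- Modulo an ideal containing all `xᵢyᵢ - pᵢ(x)`, every polynomial in `x` and `y` becomes a
polynomial in `x` alone after multiplication by a nonzero polynomial in `x`. -/
lemma MvPolynomial.exists_rename_inl_mul_sub_mem {R σ : Type*} [CommRing R] [IsDomain R]
    (p : σ → MvPolynomial σ R) (I : Ideal (MvPolynomial (σ ⊕ σ) R))
    (hI : ∀ i, X (Sum.inl i) * X (Sum.inr i) - rename Sum.inl (p i) ∈ I)
    (f : MvPolynomial (σ ⊕ σ) R) :
    ∃ d g : MvPolynomial σ R, d ≠ 0 ∧ rename Sum.inl d * f - rename Sum.inl g ∈ I := by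
  induction f using MvPolynomial.induction_on with
  | C a => exact ⟨1, C a, one_ne_zero, by simp⟩
  | add f₁ f₂ h₁ h₂ =>
    obtain ⟨d₁, g₁, hd₁, h₁⟩ := h₁
    obtain ⟨d₂, g₂, hd₂, h₂⟩ := h₂
    refine ⟨d₁ * d₂, d₂ * g₁ + d₁ * g₂, mul_ne_zero hd₁ hd₂, ?_⟩
    convert I.add_mem (I.mul_mem_left (rename Sum.inl d₂) h₁)
      (I.mul_mem_left (rename Sum.inl d₁) h₂) using 1
    simp only [map_mul, map_add]
    ring
  | mul_X f s h =>
    obtain ⟨d, g, hd, h⟩ := h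
    rcases s with j | j
    · refine ⟨d, g * X j, hd, ?_⟩
      convert I.mul_mem_left (X (Sum.inl j)) h using 1
      simp only [map_mul, rename_X]
      ring
    · refine ⟨d * X j, g * p j, mul_ne_zero hd (X_ne_zero j), ?_⟩
      convert I.add_mem (I.mul_mem_left (X (Sum.inl j) * X (Sum.inr j)) h)
        (I.mul_mem_left (rename Sum.inl g) (hI j)) using 1
      simp only [map_mul, rename_X]
      ring

open MvPolynomial in
/-- If `φ` is injective on polynomials in `x` alone and its kernel contains a prime `Q` containing
all `xᵢyᵢ - pᵢ(x)`, then its kernel is `Q`. -/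
lemma MvPolynomial.ker_le_of_isPrime {R σ S : Type*} [CommRing R] [IsDomain R] [CommRing S]
    (p : σ → MvPolynomial σ R) (φ : MvPolynomial (σ ⊕ σ) R →+* S)
    (hφ : ∀ g : MvPolynomial σ R, φ (rename Sum.inl g) = 0 → g = 0)
    (Q : Ideal (MvPolynomial (σ ⊕ σ) R)) [hQ : Q.IsPrime]
    (hI : ∀ i, X (Sum.inl i) * X (Sum.inr i) - rename Sum.inl (p i) ∈ Q)
    (hle : Q ≤ RingHom.ker φ) : RingHom.ker φ ≤ Q := by
  intro f hf
  obtain ⟨d, g, hd, h⟩ := exists_rename_inl_mul_sub_mem p Q hI f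
  have hg : g = 0 := hφ g <| by
    have := hle h
    rw [RingHom.mem_ker] at this hf
    simpa [hf] using this
  rw [hg, map_zero, sub_zero] at h
  exact (hQ.mem_or_mem h).resolve_left fun hdQ => hd (hφ d (hle hdQ))

open MvPolynomial in
/-- The defining ideal of the lower bound algebra is a minimal prime over the ideal
`I = ⟨x₁y₁ − p₁⁺ − p₁⁻, …, xₙyₙ − pₙ⁺ − pₙ⁻⟩`: the kernel `L` of the map
`k[x₁,…,xₙ,y₁,…,yₙ] → k(x₁,…,xₙ)` sending `xᵢ ↦ xᵢ` and `yᵢ ↦ xᵢ' = (pᵢ⁺ + pᵢ⁻)/xᵢ`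
is a prime ideal containing `I`, and there is no prime `Q` with `I ⊆ Q ⊊ L`. -/
theorem lower_bound_algebra_kernel_minimal_prime
    (k : Type*) [Field k] (n : ℕ) (hn : 1 ≤ n)
    (b : Fin n → Fin n → ℕ) (hloop : ∀ i, b i i = 0)
    (h2cyc : ∀ i j, min (b i j) (b j i) = 0) :
    (RingHom.ker (MvPolynomial.aeval (R := k)
        (Sum.elim
          (fun i : Fin n =>
            algebraMap (MvPolynomial (Fin n) k) (FractionRing (MvPolynomial (Fin n) k)) (X i))
          (fun i : Fin n =>
            algebraMap (MvPolynomial (Fin n) k) (FractionRing (MvPolynomial (Fin n) k))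
              ((∏ j, X j ^ b j i) + ∏ j, X j ^ b i j) /
            algebraMap (MvPolynomial (Fin n) k) (FractionRing (MvPolynomial (Fin n) k))
              (X i)))).toRingHom).IsPrime ∧
    Ideal.span (Set.range fun i : Fin n =>
        (X (Sum.inl i) * X (Sum.inr i)
          - rename Sum.inl (∏ j, X j ^ b j i) - rename Sum.inl (∏ j, X j ^ b i j) :
          MvPolynomial (Fin n ⊕ Fin n) k)) ≤
      RingHom.ker (MvPolynomial.aeval (R := k)
        (Sum.elim
          (fun i : Fin n =>
            algebraMap (MvPolynomial (Fin n) k) (FractionRing (MvPolynomial (Fin n) k)) (X i))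
          (fun i : Fin n =>
            algebraMap (MvPolynomial (Fin n) k) (FractionRing (MvPolynomial (Fin n) k))
              ((∏ j, X j ^ b j i) + ∏ j, X j ^ b i j) /
            algebraMap (MvPolynomial (Fin n) k) (FractionRing (MvPolynomial (Fin n) k))
              (X i)))).toRingHom ∧
    ∀ Q : Ideal (MvPolynomial (Fin n ⊕ Fin n) k), Q.IsPrime →
      Ideal.span (Set.range fun i : Fin n =>
          (X (Sum.inl i) * X (Sum.inr i)
            - rename Sum.inl (∏ j, X j ^ b j i) - rename Sum.inl (∏ j, X j ^ b i j) :
            MvPolynomial (Fin n ⊕ Fin n) k)) ≤ Q →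
      ¬ Q < RingHom.ker (MvPolynomial.aeval (R := k)
        (Sum.elim
          (fun i : Fin n =>
            algebraMap (MvPolynomial (Fin n) k) (FractionRing (MvPolynomial (Fin n) k)) (X i))
          (fun i : Fin n =>
            algebraMap (MvPolynomial (Fin n) k) (FractionRing (MvPolynomial (Fin n) k))
              ((∏ j, X j ^ b j i) + ∏ j, X j ^ b i j) /
            algebraMap (MvPolynomial (Fin n) k) (FractionRing (MvPolynomial (Fin n) k))
              (X i)))).toRingHom := by
  refine ⟨RingHom.ker_isPrime _, ?_, fun Q hQ hIQ hlt => hlt.not_ge ?_⟩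
  · rw [Ideal.span_le]
    rintro _ ⟨i, rfl⟩
    have hX : algebraMap (MvPolynomial (Fin n) k) (FractionRing (MvPolynomial (Fin n) k)) (X i)
        ≠ 0 := by
      simp
    simp only [SetLike.mem_coe, RingHom.mem_ker, AlgHom.toRingHom_eq_coe, RingHom.coe_coe,
      map_sub, map_mul, map_add, map_prod, map_pow, aeval_X, rename_X, Sum.elim_inl,
      Sum.elim_inr]
    rw [mul_div_cancel₀ _ hX]
    ring
  · refine MvPolynomial.ker_le_of_isPrime
      (fun i => (∏ j, X j ^ b j i) + ∏ j, X j ^ b i j) _ (fun g hg => ?_) Q (fun i => ?_) hlt.le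
    · rw [AlgHom.toRingHom_eq_coe, RingHom.coe_coe, aeval_rename, Sum.elim_comp_inl] at hg
      have h : aeval (fun i : Fin n => algebraMap (MvPolynomial (Fin n) k)
          (FractionRing (MvPolynomial (Fin n) k)) (X i)) g = algebraMap _ _ g := by
        simpa [Function.comp_def] using aeval_algebraMap_apply
          (FractionRing (MvPolynomial (Fin n) k)) (X : Fin n → MvPolynomial (Fin n) k) g
      exact (FaithfulSMul.algebraMap_eq_zero_iff _ _).mp (h.symm.trans hg)
    · rw [map_add, ← sub_sub]
      exact hIQ (Ideal.subset_span ⟨i, rfl⟩)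
end

section
/- Fix a perfect field k of prime characteristic p, an integer n ≥ 1, and a quiver without loops or directed 2-cycles on vertices {1,…,n}, encoded by a matrix b : {1,…,n}² → ℕ (where b(i,j) is the number of arrows from i to j) with b(i,i) = 0 for all i and min(b(i,j), b(j,i)) = 0 for all i,j. For each i set pᵢ⁺ = ∏_j x_j^{b(j,i)} and pᵢ⁻ = ∏_j x_j^{b(i,j)} in k[x₁,…,xₙ], and xᵢ' = (pᵢ⁺ + pᵢ⁻)/xᵢ ∈ k(x₁,…,xₙ). Let L(Q,x) be the k-subalgebra of k(x₁,…,xₙ) generated by x₁,…,xₙ,x₁',…,xₙ' (the lower bound algebra). Then L(Q,x) is Frobenius split: there exists a p^{-1}-linear map φ on L(Q,x) with φ(1) = 1. -/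
theorem IsPeLinear.exists_extension_fractionRing {R K : Type*} [CommRing R] [IsDomain R] [Field K]
    [Algebra R K] [IsFractionRing R K] {q : ℕ} (hq : q ≠ 0) {ψ : R → R} (hψ : IsPeLinear q ψ) :
    ∃ Φ : K → K, IsPeLinear q Φ ∧ ∀ r, Φ (algebraMap R K r) = algebraMap R K (ψ r) := by
  obtain ⟨hadd, hmul⟩ := hψ
  obtain ⟨m, rfl⟩ := Nat.exists_eq_add_one_of_ne_zero hq
  have hsurj : ∀ z : K, ∃ x : R × R, x.2 ≠ 0 ∧ z = algebraMap R K x.1 / algebraMap R K x.2 := by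
    intro z
    obtain ⟨x, y, hy, rfl⟩ := IsFractionRing.div_surjective (A := R) z
    exact ⟨(x, y), nonZeroDivisors.ne_zero hy, rfl⟩
  choose g hg0 hg using hsurj
  have inj := IsFractionRing.injective R K
  have hne : ∀ r : R, r ≠ 0 → algebraMap R K r ≠ 0 := fun r hr => by
    simpa using (map_ne_zero_iff _ inj).2 hr
  let Φ : K → K := fun z =>
    algebraMap R K (ψ ((g z).1 * (g z).2 ^ m)) / algebraMap R K (g z).2
  have key : ∀ a d : R, d ≠ 0 → Φ (algebraMap R K a / algebraMap R K d) =
      algebraMap R K (ψ (a * d ^ m)) / algebraMap R K d := by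
    intro a d hd
    have h := hg (algebraMap R K a / algebraMap R K d)
    have h0 := hg0 (algebraMap R K a / algebraMap R K d)
    simp only [Φ]
    generalize g (algebraMap R K a / algebraMap R K d) = x at h h0
    obtain ⟨s, t⟩ := x
    dsimp only at h h0 ⊢
    rw [div_eq_div_iff (hne _ hd) (hne _ h0), ← map_mul, ← map_mul] at h
    have h' := inj h
    rw [div_eq_div_iff (hne _ h0) (hne _ hd), ← map_mul, ← map_mul]
    congr 1
    rw [mul_comm _ d, mul_comm _ t, ← hmul, ← hmul]
    congr 1
    calc d ^ (m + 1) * (s * t ^ m) = (s * d) * (d ^ m * t ^ m) := by ring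
      _ = t ^ (m + 1) * (a * d ^ m) := by rw [← h']; ring
  refine ⟨Φ, ⟨fun z w => ?_, fun z w => ?_⟩, fun r => ?_⟩
  · obtain ⟨x, y, hy, rfl⟩ := IsFractionRing.div_surjective (A := R) z
    obtain ⟨s, t, ht, rfl⟩ := IsFractionRing.div_surjective (A := R) w
    have hy := nonZeroDivisors.ne_zero hy
    have ht := nonZeroDivisors.ne_zero ht
    rw [div_add_div _ _ (hne _ hy) (hne _ ht), ← map_mul, ← map_mul, ← map_mul, ← map_add,
      key _ _ (mul_ne_zero hy ht), key _ _ hy, key _ _ ht, map_mul,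
      div_add_div _ _ (hne _ hy) (hne _ ht), ← map_mul, ← map_mul, ← map_mul, ← map_add,
      mul_comm (ψ _) t, ← hmul, ← hmul, ← hadd]
    congr 4
    ring
  · obtain ⟨x, y, hy, rfl⟩ := IsFractionRing.div_surjective (A := R) z
    obtain ⟨s, t, ht, rfl⟩ := IsFractionRing.div_surjective (A := R) w
    have hy := nonZeroDivisors.ne_zero hy
    have ht := nonZeroDivisors.ne_zero ht
    have hyt := mul_ne_zero (pow_ne_zero (m + 1) hy) ht
    rw [div_pow, div_mul_div_comm, ← map_pow, ← map_pow, ← map_mul, ← map_mul,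
      key _ _ hyt, key _ _ ht, div_mul_div_comm, ← map_mul, ← map_mul,
      div_eq_div_iff (hne _ hyt) (hne _ (mul_ne_zero hy ht)), ← map_mul, ← map_mul]
    congr 1
    have : x ^ (m + 1) * s * (y ^ (m + 1) * t) ^ m =
        (x * y ^ m) ^ (m + 1) * (s * t ^ m) := by
      rw [mul_pow, mul_pow, ← pow_mul, ← pow_mul, mul_comm (m + 1) m]; ring
    rw [this, hmul]
    ring
  · simpa using key r 1 one_ne_zero

open MvPolynomial in
theorem MvPolynomial.exists_frobenius_trace {σ k : Type*} [Field k] (p : ℕ) [Fact p.Prime]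
    [CharP k p] [PerfectRing k p] :
    ∃ ψ : MvPolynomial σ k → MvPolynomial σ k,
      (∀ g α, coeff α (ψ g) ^ p = coeff (p • α) g) ∧ IsPeLinear p ψ ∧ ψ 1 = 1 := by
  classical
  have hp0 : p ≠ 0 := (Fact.out : p.Prime).ne_zero
  have hinj : Function.Injective fun α : σ →₀ ℕ => p • α := fun a b h => by
    ext i
    have := DFunLike.congr_fun h i
    simpa [hp0] using this
  have hex : ∀ g : MvPolynomial σ k, ∃ h : MvPolynomial σ k,
      ∀ α, coeff α h ^ p = coeff (p • α) g := by
    intro g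
    refine ⟨∑ α ∈ g.support.preimage (fun α => p • α) hinj.injOn,
      monomial α ((frobeniusEquiv k p).symm (coeff (p • α) g)), fun α => ?_⟩
    rw [coeff_sum]
    simp only [coeff_monomial, Finset.sum_ite_eq', Finset.mem_preimage, mem_support_iff]
    split_ifs with h
    · exact frobenius_apply_frobeniusEquiv_symm k p _
    · rw [zero_pow hp0]; simpa using Eq.symm (not_not.1 h)
  choose ψ hψ using hex
  have hk : Function.Injective fun c : k => c ^ p := frobenius_inj k p
  have hadd : ∀ a b, ψ (a + b) = ψ a + ψ b := fun a b => by
    ext α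
    apply hk
    simp only [coeff_add, add_pow_char, hψ]
  refine ⟨ψ, hψ, ⟨hadd, fun a b => ?_⟩, ?_⟩
  · induction a using MvPolynomial.induction_on' with
    | monomial β c =>
      ext α
      apply hk
      simp only [hψ, monomial_pow, coeff_monomial_mul']
      have : p • β ≤ p • α ↔ β ≤ α := by
        simp only [Finsupp.le_def, Finsupp.smul_apply, smul_eq_mul]
        exact forall_congr' fun i => Nat.mul_le_mul_left_iff (Nat.pos_of_ne_zero hp0)
      simp only [this]
      split_ifs with h
      · rw [mul_pow, hψ]
        congr 2
        ext i
        simp [Nat.mul_sub]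
      · rw [zero_pow hp0]
    | add a a' ha ha' => rw [add_pow_char, add_mul, hadd, ha, ha', add_mul]
  · ext α
    apply hk
    simp only [hψ, coeff_one]
    have : (0 = p • α) ↔ 0 = α := by
      rw [eq_comm, eq_comm (a := 0)]
      constructor
      · intro h; exact hinj (by simpa using h)
      · rintro rfl; simp
    simp only [this]
    split_ifs <;> simp [hp0]

open MvPolynomial in
theorem MvPolynomial.prod_X_dvd_of_coeff_pow {σ k : Type*} [Fintype σ] [Field k] {p : ℕ}
    (hp : p ≠ 0) {h g : MvPolynomial σ k} (hh : ∀ α, coeff α h ^ p = coeff (p • α) g)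
    (hg : (∏ i, X i) ∣ g) : (∏ i, X i) ∣ h := by
  have hM : (∏ i, X i : MvPolynomial σ k) = monomial (∑ i, Finsupp.single i 1) 1 := by
    simp [monomial_sum_one, X]
  rw [hM] at hg ⊢
  obtain ⟨g, rfl⟩ := hg
  rw [monomial_one_dvd_iff_modMonomial_eq_zero]
  ext α
  by_cases hα : (∑ i, Finsupp.single i 1) ≤ α
  · rw [coeff_modMonomial_of_le _ hα, coeff_zero]
  · rw [coeff_modMonomial_of_not_le _ hα, coeff_zero]
    have := hh α
    rw [coeff_monomial_mul', if_neg] at this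
    · exact pow_eq_zero_iff hp |>.1 this
    · intro hle
      apply hα
      intro i
      have hi := hle i
      have h1 : (∑ j, Finsupp.single j 1 : σ →₀ ℕ) i = 1 := by
        classical
        simp [Finsupp.finsetSum_apply, Finsupp.single_apply]
      rw [h1, Finsupp.smul_apply, smul_eq_mul] at hi
      rw [h1]
      exact Nat.pos_of_mul_pos_left hi

open MvPolynomial in
theorem exists_frobenius_splitting_adjoin_div_X {σ k K : Type*} [Fintype σ] [Field k] [Field K]
    [Algebra (MvPolynomial σ k) K] [IsFractionRing (MvPolynomial σ k) K]
    [Algebra k K] [IsScalarTower k (MvPolynomial σ k) K] (p : ℕ) [Fact p.Prime]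
    [CharP k p] [PerfectRing k p] (f : σ → MvPolynomial σ k) :
    ∃ φ : Algebra.adjoin k ((Set.range fun i => algebraMap (MvPolynomial σ k) K (X i)) ∪
          Set.range fun i => algebraMap (MvPolynomial σ k) K (f i) /
            algebraMap (MvPolynomial σ k) K (X i)) →
        Algebra.adjoin k ((Set.range fun i => algebraMap (MvPolynomial σ k) K (X i)) ∪
          Set.range fun i => algebraMap (MvPolynomial σ k) K (f i) /
            algebraMap (MvPolynomial σ k) K (X i)),
      IsPeLinear p φ ∧ φ 1 = 1 := by
  set A := algebraMap (MvPolynomial σ k) K with hA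
  set L := Algebra.adjoin k ((Set.range fun i => A (X i)) ∪ Set.range fun i => A (f i) / A (X i))
  have hp : p ≠ 0 := (Fact.out : p.Prime).ne_zero
  obtain ⟨ψ, hcoeff, hψ, hψ1⟩ := MvPolynomial.exists_frobenius_trace (σ := σ) (k := k) p
  obtain ⟨Φ, ⟨hadd, hmul⟩, hΦ⟩ := hψ.exists_extension_fractionRing (K := K) hp
  have hX : ∀ i, A (X i) ≠ 0 := fun i =>
    (map_ne_zero_iff _ (IsFractionRing.injective _ K)).2 (X_ne_zero i)
  have hAL : ∀ g, A g ∈ L := by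
    intro g
    have hcomp : A g = aeval (fun i => A (X i)) g := by
      have h : IsScalarTower.toAlgHom k (MvPolynomial σ k) K = aeval fun i => A (X i) := by
        ext i; simp [hA]
      exact DFunLike.congr_fun h g
    rw [hcomp]
    have := (aeval (R := k) fun i => A (X i)).mem_range_self g
    rw [← Algebra.adjoin_range_eq_range_aeval] at this
    exact Algebra.adjoin_mono Set.subset_union_left this
  have hfL : ∀ i, A (f i) / A (X i) ∈ L := fun i => Algebra.subset_adjoin (Or.inr ⟨i, rfl⟩)
  have hlow : ∀ (g : MvPolynomial σ k) (r : σ → ℕ), (∀ i, r i < p) →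
      Φ (A g * ∏ i, (A (f i) / A (X i)) ^ r i) ∈ L := by
    intro g r hr
    have hM : (∏ i, A (X i)) ≠ 0 := Finset.prod_ne_zero_iff.2 fun i _ => hX i
    have hdvd : (∏ i, X i) ∣ ψ (g * ∏ i, f i ^ r i * X i ^ (p - r i)) :=
      prod_X_dvd_of_coeff_pow hp (hcoeff _) (Dvd.dvd.mul_left (Finset.prod_dvd_prod_of_dvd _ _
        fun i _ => Dvd.dvd.mul_left (dvd_pow_self _ (Nat.sub_ne_zero_of_lt (hr i))) _) _)
    obtain ⟨h, hh⟩ := hdvd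
    have hz : (∏ i, A (X i)) ^ p * (A g * ∏ i, (A (f i) / A (X i)) ^ r i) =
        A (g * ∏ i, f i ^ r i * X i ^ (p - r i)) := by
      rw [map_mul, map_prod, mul_left_comm, ← Finset.prod_pow, ← Finset.prod_mul_distrib]
      congr 1
      refine Finset.prod_congr rfl fun i _ => ?_
      rw [map_mul, map_pow, map_pow, div_pow, mul_div_assoc', div_eq_iff (pow_ne_zero _ (hX i)),
        mul_assoc, ← pow_add, Nat.sub_add_cancel (hr i).le, mul_comm]
    have hΦz := hmul (∏ i, A (X i)) (A g * ∏ i, (A (f i) / A (X i)) ^ r i)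
    rw [hz, hΦ, hh, map_mul, map_prod] at hΦz
    rw [← mul_left_cancel₀ hM hΦz]
    exact hAL h
  have hstable : ∀ z ∈ L, Φ z ∈ L := by
    intro z hz
    have hle : L ≤ (aeval (R := MvPolynomial σ k) fun i => A (f i) / A (X i)).range.restrictScalars
        k := by
      refine Algebra.adjoin_le ?_
      rintro _ (⟨i, rfl⟩ | ⟨i, rfl⟩)
      · exact ⟨C (X i), by simp [hA]⟩
      · exact ⟨X i, by simp⟩
    obtain ⟨G, rfl⟩ := hle hz
    clear hz
    induction G using MvPolynomial.induction_on' with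
    | monomial m g =>
      have : aeval (fun i => A (f i) / A (X i)) (monomial m g) =
          (∏ i, (A (f i) / A (X i)) ^ (m i / p)) ^ p *
            (A g * ∏ i, (A (f i) / A (X i)) ^ (m i % p)) := by
        rw [aeval_monomial, Finsupp.prod_fintype _ _ (by simp), mul_left_comm, ← Finset.prod_pow,
          ← Finset.prod_mul_distrib]
        congr 1
        refine Finset.prod_congr rfl fun i _ => ?_
        rw [← pow_mul, ← pow_add, Nat.div_add_mod']
      change Φ (aeval _ _) ∈ L
      rw [this, hmul]
      exact L.mul_mem (L.prod_mem fun i _ => L.pow_mem (hfL i) _)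
        (hlow _ _ fun i => Nat.mod_lt _ (Nat.pos_of_ne_zero hp))
    | add G H hG hH =>
      rw [map_add, hadd]
      exact L.add_mem hG hH
  refine ⟨fun z => ⟨Φ z, hstable _ z.2⟩, ⟨fun z w => Subtype.ext (hadd _ _),
    fun z w => Subtype.ext (hmul _ _)⟩, Subtype.ext ?_⟩
  have := hΦ 1
  rw [hψ1, map_one] at this
  exact this

open MvPolynomial in
/-- The lower bound algebra `L(Q,x) = k[x₁,…,xₙ,x₁',…,xₙ'] ⊆ k(x₁,…,xₙ)` of a quiver
without loops or directed 2-cycles, over a perfect field `k` of characteristic `p`, is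
Frobenius split: there is a `p^{-1}`-linear map `φ` on it with `φ 1 = 1`. -/
theorem lower_bound_algebra_frobenius_split
    (k : Type*) [Field k] [PerfectField k] (p : ℕ) [Fact p.Prime] [CharP k p]
    (n : ℕ) (hn : 1 ≤ n)
    (b : Fin n → Fin n → ℕ) (hloop : ∀ i, b i i = 0)
    (h2cyc : ∀ i j, min (b i j) (b j i) = 0) :
    ∃ φ : (Algebra.adjoin k
          ((Set.range fun i : Fin n =>
              algebraMap (MvPolynomial (Fin n) k) (FractionRing (MvPolynomial (Fin n) k))
                (X i)) ∪
            (Set.range fun i : Fin n =>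
              algebraMap (MvPolynomial (Fin n) k) (FractionRing (MvPolynomial (Fin n) k))
                ((∏ j, X j ^ b j i) + ∏ j, X j ^ b i j) /
              algebraMap (MvPolynomial (Fin n) k) (FractionRing (MvPolynomial (Fin n) k))
                (X i)))) →
        (Algebra.adjoin k
          ((Set.range fun i : Fin n =>
              algebraMap (MvPolynomial (Fin n) k) (FractionRing (MvPolynomial (Fin n) k))
                (X i)) ∪
            (Set.range fun i : Fin n =>
              algebraMap (MvPolynomial (Fin n) k) (FractionRing (MvPolynomial (Fin n) k))
                ((∏ j, X j ^ b j i) + ∏ j, X j ^ b i j) /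
              algebraMap (MvPolynomial (Fin n) k) (FractionRing (MvPolynomial (Fin n) k))
                (X i)))),
      IsPeLinear (p ^ 1) φ ∧ φ 1 = 1 := by
  rw [pow_one]
  exact exists_frobenius_splitting_adjoin_div_X p
    fun i => (∏ j, X j ^ b j i) + ∏ j, X j ^ b i j
end

section
/- Let k be a field, n ≥ 1, and F = k(x₁,…,xₙ) the field of rational functions in n variables over k. Let m⁺ and m⁻ be monomials in the variables x₂,…,xₙ (not involving x₁) with disjoint supports and not both equal to 1, and set x₁' := (m⁺ + m⁻)/x₁ ∈ F. Then in the n-th exterior power ⋀ⁿ_F Ω_{F/k} of the module of Kähler differentials of F over k, the log volume forms of the clusters {x₁,…,xₙ} and {x₁',x₂,…,xₙ} differ exactly by a sign: (x₁'x₂⋯xₙ)^{-1}·(dx₁' ∧ dx₂ ∧ ⋯ ∧ dxₙ) = −(x₁x₂⋯xₙ)^{-1}·(dx₁ ∧ dx₂ ∧ ⋯ ∧ dxₙ). -/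
open scoped ExteriorAlgebra

/-- An alternating map vanishes when one argument lies in the span of the others. -/
theorem AlternatingMap.map_update_eq_zero_of_mem_span {R M N ι : Type*} [CommRing R]
    [AddCommGroup M] [Module R M] [AddCommGroup N] [Module R N] [DecidableEq ι]
    (f : M [⋀^ι]→ₗ[R] N) (w : ι → M) (i : ι) {z : M}
    (hz : z ∈ Submodule.span R (w '' {j | j ≠ i})) : f (Function.update w i z) = 0 := by
  induction hz using Submodule.span_induction with
  | mem z hz =>
    obtain ⟨j, hj, rfl⟩ := hz
    exact f.map_update_self w (Ne.symm hj)
  | zero => exact f.map_update_zero w i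
  | add a b _ _ ha hb => rw [f.map_update_add, ha, hb, add_zero]
  | smul c a _ ha => rw [f.map_update_smul, ha, smul_zero]

/-- The derivative of a monomial lies in the span of the derivatives of the variables occurring
in it. -/
theorem Derivation.prod_pow_mem_span {k A M ι : Type*} [CommRing k] [CommRing A] [Algebra k A]
    [AddCommGroup M] [Module A M] [Module k M] (D : Derivation k A M) (s : Finset ι) (x : ι → A)
    (u : ι → ℕ) (i : ι) (hu : u i = 0) :
    D (∏ j ∈ s, x j ^ u j) ∈ Submodule.span A ((fun j => D (x j)) '' {j | j ≠ i}) := by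
  refine Finset.prod_induction _
    (fun a => D a ∈ Submodule.span A ((fun j => D (x j)) '' {j | j ≠ i})) ?_ ?_ ?_
  · intro a b ha hb
    rw [D.leibniz]
    exact add_mem (Submodule.smul_mem _ _ hb) (Submodule.smul_mem _ _ ha)
  · rw [D.map_one_eq_zero]
    exact zero_mem _
  · intro j _
    by_cases hj : j = i
    · subst hj
      rw [hu, pow_zero, D.map_one_eq_zero]
      exact zero_mem _
    · have hmem : D (x j) ∈ Submodule.span A ((fun j => D (x j)) '' {j | j ≠ i}) :=
        Submodule.subset_span ⟨j, hj, rfl⟩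
      rw [D.leibniz_pow]
      exact nsmul_mem (Submodule.smul_mem _ _ hmem) _

/-- Replacing the variable `x i` by `p / x i`, where `dp` is a combination of the derivatives of the
other variables, changes the sign of the log volume form. -/
theorem AlternatingMap.logForm_update_div {k F M N ι : Type*} [CommRing k] [Field F] [Algebra k F]
    [AddCommGroup M] [Module F M] [Module k M] [AddCommGroup N] [Module F N]
    [Fintype ι] [DecidableEq ι] (f : M [⋀^ι]→ₗ[F] N) (D : Derivation k F M) (x : ι → F) (i : ι)
    (hx : x i ≠ 0) {p : F} (hp : p ≠ 0)
    (hD : D p ∈ Submodule.span F ((fun j => D (x j)) '' {j | j ≠ i})) :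
    (∏ j, Function.update x i (p / x i) j)⁻¹ •
        f (fun j => D (Function.update x i (p / x i) j)) =
      -((∏ j, x j)⁻¹ • f (fun j => D (x j))) := by
  have hw : (fun j => D (Function.update x i (p / x i) j)) =
      Function.update (fun j => D (x j)) i (D (p / x i)) := by
    ext j
    exact Function.apply_update (fun _ => D) x i (p / x i) j
  have hform : f (Function.update (fun j => D (x j)) i (D (p / x i))) =
      -((p / x i ^ 2) • f (fun j => D (x j))) := by
    have hdiv : D (p / x i) = (x i)⁻¹ • D p + (-(p / x i ^ 2)) • D (x i) := by
      rw [D.leibniz_div, smul_sub, smul_smul, smul_smul, neg_smul, ← sub_eq_add_neg]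
      congr 2 <;> field_simp
    rw [hdiv, f.map_update_add, f.map_update_smul, f.map_update_smul,
      f.map_update_eq_zero_of_mem_span _ i hD, smul_zero, zero_add, neg_smul,
      Function.update_eq_self]
  rw [hw, hform, Finset.prod_update_of_mem (Finset.mem_univ i), smul_neg, smul_smul,
    ← Finset.mul_prod_erase Finset.univ x (Finset.mem_univ i), Finset.sdiff_singleton_eq_erase]
  congr 2
  rw [mul_inv, mul_inv]
  field_simp

/-- The sum of two distinct monomials is nonzero. -/
theorem MvPolynomial.prod_X_pow_add_prod_X_pow_ne_zero {k σ : Type*} [CommSemiring k] [Nontrivial k]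
    [Fintype σ] {u v : σ → ℕ} (huv : u ≠ v) :
    (∏ j, (X j : MvPolynomial σ k) ^ u j) + ∏ j, X j ^ v j ≠ 0 := by
  classical
  have hmon (w : σ → ℕ) : (∏ j, (X j : MvPolynomial σ k) ^ w j) =
      monomial (Finsupp.equivFunOnFinite.symm w) 1 := by
    rw [monomial_eq, C_1, one_mul, Finsupp.prod_fintype _ _ fun _ => pow_zero _]
    rfl
  intro h
  have hc := congrArg (coeff (Finsupp.equivFunOnFinite.symm u)) h
  rw [hmon, hmon, coeff_add, coeff_monomial, coeff_monomial, if_pos rfl,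
    if_neg fun e => huv (Finsupp.equivFunOnFinite.symm.injective e).symm, add_zero,
    coeff_zero] at hc
  exact one_ne_zero hc

open MvPolynomial in
/-- In `⋀ⁿ_F Ω_{F/k}` for `F = k(x₁,…,xₙ)`, the log volume form of the mutated cluster
`{x₁', x₂, …, xₙ}`, where `x₁' = (m⁺ + m⁻)/x₁` for monomials `m⁺ = x^u`, `m⁻ = x^v` in
`x₂,…,xₙ` with disjoint supports and not both equal to `1`, equals minus the log volume
form of the cluster `{x₁,…,xₙ}`. -/
theorem logVolumeForm_mutation_sign
    (k : Type*) [Field k] (n : ℕ) (hn : 1 ≤ n)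
    (u v : Fin n → ℕ) (hu0 : u ⟨0, hn⟩ = 0) (hv0 : v ⟨0, hn⟩ = 0)
    (hdisj : ∀ i, u i = 0 ∨ v i = 0) (hnontriv : u ≠ 0 ∨ v ≠ 0) :
    (∏ i, Function.update
          (fun j : Fin n =>
            algebraMap (MvPolynomial (Fin n) k) (FractionRing (MvPolynomial (Fin n) k)) (X j))
          ⟨0, hn⟩
          (((∏ j, (algebraMap (MvPolynomial (Fin n) k)
                (FractionRing (MvPolynomial (Fin n) k)) (X j)) ^ (u j)) +
            ∏ j, (algebraMap (MvPolynomial (Fin n) k)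
                (FractionRing (MvPolynomial (Fin n) k)) (X j)) ^ (v j)) /
            algebraMap (MvPolynomial (Fin n) k) (FractionRing (MvPolynomial (Fin n) k))
              (X ⟨0, hn⟩)) i)⁻¹ •
      ExteriorAlgebra.ιMulti (FractionRing (MvPolynomial (Fin n) k)) n
        (fun i => KaehlerDifferential.D k (FractionRing (MvPolynomial (Fin n) k))
          (Function.update
            (fun j : Fin n =>
              algebraMap (MvPolynomial (Fin n) k) (FractionRing (MvPolynomial (Fin n) k)) (X j))
            ⟨0, hn⟩
            (((∏ j, (algebraMap (MvPolynomial (Fin n) k)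
                  (FractionRing (MvPolynomial (Fin n) k)) (X j)) ^ (u j)) +
              ∏ j, (algebraMap (MvPolynomial (Fin n) k)
                  (FractionRing (MvPolynomial (Fin n) k)) (X j)) ^ (v j)) /
              algebraMap (MvPolynomial (Fin n) k) (FractionRing (MvPolynomial (Fin n) k))
                (X ⟨0, hn⟩)) i)) =
    - ((∏ i, algebraMap (MvPolynomial (Fin n) k)
          (FractionRing (MvPolynomial (Fin n) k)) (X i))⁻¹ •
        ExteriorAlgebra.ιMulti (FractionRing (MvPolynomial (Fin n) k)) n
          (fun i => KaehlerDifferential.D k (FractionRing (MvPolynomial (Fin n) k))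
            (algebraMap (MvPolynomial (Fin n) k)
              (FractionRing (MvPolynomial (Fin n) k)) (X i)))) := by
  have hinj : Function.Injective
      (algebraMap (MvPolynomial (Fin n) k) (FractionRing (MvPolynomial (Fin n) k))) :=
    IsFractionRing.injective _ _
  have huv : u ≠ v := by
    rintro rfl
    have hu : u = 0 := funext fun i => (hdisj i).elim id id
    exact hnontriv.elim (fun h => h hu) fun h => h hu
  refine AlternatingMap.logForm_update_div (ExteriorAlgebra.ιMulti _ n)
    (KaehlerDifferential.D k (FractionRing (MvPolynomial (Fin n) k)))
    (fun j => algebraMap _ _ (X j)) ⟨0, hn⟩ ?_ ?_ ?_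
  · exact (map_ne_zero_iff _ hinj).2 (X_ne_zero _)
  · simpa only [map_add, map_prod, map_pow] using
      (map_ne_zero_iff _ hinj).2 (prod_X_pow_add_prod_X_pow_ne_zero (k := k) huv)
  · rw [map_add]
    exact add_mem (Derivation.prod_pow_mem_span _ _ _ u _ hu0)
      (Derivation.prod_pow_mem_span _ _ _ v _ hv0)
end
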